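/- arXiv:2009.10998 — 2 statements merged into one kernel-verified Lean document; each statement's English description precedes it below -/
import Mathlib

section
/- In the positive braid monoid B⁺ of a Coxeter system, any two elements admit a greatest common prefix: the set of common left-divisors of b₁, b₂ ∈ B⁺, ordered by left-divisibility, has a greatest element. -/
/-!
STATEMENT 2.  In the positive braid monoid `B⁺` of a Coxeter system (the monoid
presented by the simple reflections subject only to the braid relations), any
two elements admit a greatest common prefix: the set of common left-divisors of
`b₁, b₂ ∈ B⁺`, ordered by left-divisibility, has a greatest element.

Here `a` left-divides `b` iff `∃ c, b = a * c`, which is exactly the monoid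
divisibility `a ∣ b`.
-/

open CoxeterSystem

/-- The braid relations associated to a Coxeter matrix `M`: for each pair of
indices `i, i'`, the two alternating words of length `M i i'` are identified. -/
def CoxeterMatrix.braidRels {B : Type*} (M : CoxeterMatrix B) :
    FreeMonoid B → FreeMonoid B → Prop := fun a b =>
  ∃ i i' : B,
    a = FreeMonoid.ofList (alternatingWord i i' (M i i')) ∧
    b = FreeMonoid.ofList (alternatingWord i' i (M i i'))

/-- The positive braid monoid of a Coxeter matrix `M`. -/
def CoxeterMatrix.BraidMonoid {B : Type*} (M : CoxeterMatrix B) : Type _ :=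
  PresentedMonoid M.braidRels

noncomputable instance {B : Type*} (M : CoxeterMatrix B) : Monoid M.BraidMonoid :=
  inferInstanceAs (Monoid (PresentedMonoid M.braidRels))

namespace BraidGCD

open Polynomial.Chebyshev Module

variable {B : Type*} (M : CoxeterMatrix B)

/-! ### The geometric representation and the order of a product of two simple reflections -/

/-- The coroot functional of the geometric representation. -/
noncomputable def coroot (i : B) : Dual ℝ (B →₀ ℝ) :=
  Finsupp.linearCombination ℝ (fun j => -2 * Real.cos (Real.pi / (M i j : ℝ)))

theorem coroot_single (i j : B) :
    coroot M i (Finsupp.single j 1) = -2 * Real.cos (Real.pi / (M i j : ℝ)) := by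
  simp [coroot]

theorem coroot_self (i : B) : coroot M i (Finsupp.single i 1) = 2 := by
  rw [coroot_single, M.diagonal i]; simp

/-- The simple reflection of the geometric representation. -/
noncomputable def geomRefl (i : B) : (B →₀ ℝ) ≃ₗ[ℝ] (B →₀ ℝ) := Module.reflection (coroot_self M i)

theorem coroot_prod (i j : B) :
    2 * Real.cos (2 * Real.pi / (M i j : ℝ)) =
      coroot M i (Finsupp.single j 1) * coroot M j (Finsupp.single i 1) - 2 := by
  rw [coroot_single, coroot_single, M.symmetric j i, mul_div_assoc, Real.cos_two_mul]
  ring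

theorem sin_pos_of_three_le {m : ℕ} (hm : 3 ≤ m) : 0 < Real.sin (2 * Real.pi / (m : ℝ)) := by
  have h3 : (3 : ℝ) ≤ m := by exact_mod_cast hm
  apply Real.sin_pos_of_pos_of_lt_pi
  · have := Real.pi_pos; positivity
  · rw [div_lt_iff₀ (by linarith)]
    nlinarith [Real.pi_pos]

theorem geomRefl_pow (i j : B) : (geomRefl M i * geomRefl M j) ^ M i j = 1 := by
  by_cases hij : i = j
  · subst hij
    rw [M.diagonal i, pow_one]
    ext1 z
    exact involutive_reflection (coroot_self M i) z
  have h1 : M i j ≠ 1 := M.off_diagonal i j hij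
  ext1 z
  rw [geomRefl, geomRefl, reflection_mul_reflection_pow_apply (coroot_self M i) (coroot_self M j)
    (M i j) z _ (coroot_prod M i j)]
  generalize hm : M i j = m at h1
  rcases Nat.lt_or_ge m 3 with h | h
  · interval_cases m
    · simp
    · exact absurd rfl h1
    · have hc : coroot M i (Finsupp.single j 1) = 0 := by rw [coroot_single, hm]; simp
      have hd : coroot M j (Finsupp.single i 1) = 0 := by
        rw [coroot_single, M.symmetric j i, hm]; simp
      rw [hc, hd]
      have h2 : (2 * Real.cos (2 * Real.pi / ((2 : ℕ) : ℝ))) = -2 := by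
        norm_num
      rw [h2]
      norm_num [S_eval_neg_two]
      module
  · have hs := sin_pos_of_three_le h
    set θ := 2 * Real.pi / (m : ℝ) with hθ
    have hS : ∀ n : ℤ, (S ℝ n).eval (2 * Real.cos θ) = Real.sin ((n + 1) * θ) / Real.sin θ := by
      intro n
      rw [eq_div_iff hs.ne', S_two_mul_real_cos]
    have hm0 : (m : ℝ) ≠ 0 := by positivity
    rcases Nat.even_or_odd' m with ⟨a, ha | ha⟩
    · have e1 : ((m : ℤ) - 2) / 2 = a - 1 := by omega
      have e2 : ((m : ℤ) - 1) / 2 = a - 1 := by omega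
      have : (S ℝ ((a : ℤ) - 1)).eval (2 * Real.cos θ) = 0 := by
        rw [hS]
        have : ((((a : ℤ) - 1 : ℤ) : ℝ) + 1) * θ = Real.pi := by
          have ha0 : (a : ℝ) ≠ 0 := by
            intro h0; apply hm0; rw [ha]; push_cast; rw [h0]; simp
          rw [hθ, ha]; push_cast; field_simp; ring
        rw [this]; simp
      rw [e1, e2, this]; simp
    · have e1 : ((m : ℤ) - 2) / 2 = a - 1 := by omega
      have e2 : ((m : ℤ) - 1) / 2 = a := by omega
      have e3 : ((m : ℤ) - 3) / 2 = a - 1 := by omega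
      have e4 : (m : ℤ) / 2 = a := by omega
      have : (S ℝ (a : ℤ)).eval (2 * Real.cos θ) + (S ℝ ((a : ℤ) - 1)).eval (2 * Real.cos θ) = 0 := by
        rw [hS, hS, ← add_div]
        have : (((a : ℤ) : ℝ) + 1) * θ = 2 * Real.pi - ((((a : ℤ) - 1 : ℤ) : ℝ) + 1) * θ := by
          rw [hθ, ha]; rw [ha] at hm0; push_cast at hm0 ⊢; field_simp; ring
        rw [this, Real.sin_two_pi_sub]; simp
      rw [e1, e2, e3, e4, this]; simp

theorem geomRefl_pow_ne (i j : B) (hij : i ≠ j) (k : ℕ) (hk : 0 < k) (hkm : M i j = 0 ∨ k < M i j) :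
    (geomRefl M i * geomRefl M j) ^ k ≠ 1 := by
  intro h
  have h0 := reflection_mul_reflection_pow_apply_self (coroot_self M i) (coroot_self M j)
    k _ (coroot_prod M i j)
  change ((geomRefl M i * geomRefl M j) ^ k) (Finsupp.single i 1) = _ at h0
  rw [h] at h0
  have hi := DFunLike.congr_fun h0 i
  have hj := DFunLike.congr_fun h0 j
  have hc : coroot M j (Finsupp.single i 1) = -2 * Real.cos (Real.pi / (M i j : ℝ)) := by
    rw [coroot_single, M.symmetric j i]
  simp only [LinearEquiv.coe_one, id_eq, Finsupp.add_apply, Finsupp.smul_apply,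
    Finsupp.single_eq_same, Finsupp.single_eq_of_ne hij, Finsupp.single_eq_of_ne hij.symm,
    smul_eq_mul, mul_one, mul_zero, add_zero, zero_add, hc] at hi hj
  have h1 : M i j ≠ 1 := M.off_diagonal i j hij
  clear h0 hc h
  generalize M i j = m at *
  rcases Nat.lt_or_ge m 3 with hm | hm
  · interval_cases m
    · simp [S_eval_two] at hj
      omega
    · exact absurd rfl h1
    · have : k = 1 := by omega
      subst this
      have h2 : (2 * Real.cos (2 * Real.pi / ((2 : ℕ) : ℝ))) = -2 := by
        norm_num
      rw [h2] at hi
      norm_num [S_eval_neg_two] at hi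
  · have hs := sin_pos_of_three_le hm
    have hkm : k < m := by omega
    have hm3 : (3 : ℝ) ≤ m := by exact_mod_cast hm
    have hcos : 0 < Real.cos (Real.pi / (m : ℝ)) := by
      apply Real.cos_pos_of_mem_Ioo
      have := Real.pi_pos
      constructor
      · have : 0 < Real.pi / (m : ℝ) := by positivity
        linarith
      · rw [div_lt_div_iff₀ (by linarith) (by norm_num)]
        nlinarith
    set θ := 2 * Real.pi / (m : ℝ) with hθ
    have hS : ∀ n : ℤ, (S ℝ n).eval (2 * Real.cos θ) = Real.sin ((n + 1) * θ) / Real.sin θ := by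
      intro n
      rw [eq_div_iff hs.ne', S_two_mul_real_cos]
    have hz : (S ℝ ((k : ℤ) - 1)).eval (2 * Real.cos θ) = 0 := by
      rcases mul_eq_zero.mp hj.symm with h | h
      · exact h
      · linarith
    rw [hz, add_zero, hS, eq_div_iff hs.ne'] at hi
    rw [hS, div_eq_zero_iff, or_iff_left hs.ne'] at hz
    have e1 : (((((k : ℤ) - 1 : ℤ)) : ℝ) + 1) * θ = k * θ := by push_cast; ring
    have e2 : (((k : ℤ) : ℝ) + 1) * θ = k * θ + θ := by push_cast; ring
    rw [e1] at hz
    rw [e2, Real.sin_add, hz, zero_mul, zero_add] at hi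
    have hcos1 : Real.cos (k * θ) = 1 := by
      have : (Real.cos (k * θ) - 1) * Real.sin θ = 0 := by linarith
      rcases mul_eq_zero.mp this with h | h
      · linarith
      · exact absurd h hs.ne'
    have hpos : 0 < (k : ℝ) * θ := by
      have := Real.pi_pos
      positivity
    have hlt : (k : ℝ) * θ < 2 * Real.pi := by
      have hk' : (k : ℝ) < m := by exact_mod_cast hkm
      rw [hθ, ← mul_div_assoc, div_lt_iff₀ (by linarith)]
      nlinarith [Real.pi_pos]
    have := (Real.cos_eq_one_iff_of_lt_of_lt (by linarith [Real.pi_pos]) hlt).mp hcos1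
    linarith

variable {M} {W : Type*} [Group W] (cs : CoxeterSystem M W)

theorem simple_pow_ne (i j : B) (hij : i ≠ j) (k : ℕ) (hk : 0 < k) (hkm : M i j = 0 ∨ k < M i j) :
    (cs.simple i * cs.simple j) ^ k ≠ 1 := by
  intro h
  have hl : M.IsLiftable (geomRefl M) := geomRefl_pow M
  have h2 := congrArg (cs.lift ⟨geomRefl M, hl⟩) h
  rw [map_pow, map_mul, map_one, CoxeterSystem.lift_apply_simple,
    CoxeterSystem.lift_apply_simple] at h2
  exact geomRefl_pow_ne M i j hij k hk hkm h2

/-! ### Inversion parity and the exchange property -/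

open Classical in
/-- The action of a simple reflection on `W × ZMod 2`. -/
noncomputable def flip (i : B) : Function.End (W × ZMod 2) :=
  fun p => (cs.simple i * p.1 * cs.simple i, p.2 + if p.1 = cs.simple i then 1 else 0)

theorem flip_aux (a b x : W) (ha : a * a = 1) (hb : b * b = 1) (n : ℕ) :
    ((a * b) ^ n * x * ((a * b) ^ n)⁻¹ = b ↔ x = ((a * b) ^ (2 * n))⁻¹ * b) ∧
    (b * ((a * b) ^ n * x * ((a * b) ^ n)⁻¹) * b = a ↔ x = ((a * b) ^ (2 * n + 1))⁻¹ * b) := by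
  have ha' : a⁻¹ = a := inv_eq_of_mul_eq_one_left ha
  have hb' : b⁻¹ = b := inv_eq_of_mul_eq_one_left hb
  have key : b * (a * b) ^ n = ((a * b) ^ n)⁻¹ * b := by
    have h1 : b * (a * b) * b⁻¹ = (a * b)⁻¹ := by
      rw [mul_inv_rev, ha', hb']; simp [mul_assoc, hb]
    have h2 : b * (a * b) ^ n * b⁻¹ = ((a * b) ^ n)⁻¹ := by
      rw [← conj_pow, h1, inv_pow]
    rw [← h2]; simp
  have comm : Commute ((a * b) ^ n)⁻¹ (b * a) := by
    have : b * a = (a * b)⁻¹ := by rw [mul_inv_rev, ha', hb']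
    rw [this]
    exact ((Commute.refl (a * b)).pow_left n).inv_inv
  have conj_iff : ∀ c y z : W, c * y * c⁻¹ = z ↔ y = c⁻¹ * z * c := by
    intro c y z
    constructor
    · rintro rfl; group
    · rintro rfl; group
  generalize hc : (a * b) ^ n = c at key comm
  have hcsq : (a * b) ^ (2 * n) = c * c := by rw [two_mul, pow_add, hc]
  constructor
  · rw [conj_iff, hcsq, mul_inv_rev, mul_assoc c⁻¹, mul_assoc c⁻¹, ← key]
  · have e1 : b * (c * x * c⁻¹) * b = a ↔ c * x * c⁻¹ = b * a * b := by
      constructor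
      · intro h
        rw [← h]; simp only [mul_assoc, hb, mul_one]
        rw [← mul_assoc b b, hb, one_mul]
      · intro h
        rw [h]; simp only [mul_assoc, hb, mul_one]
        rw [← mul_assoc b b, hb, one_mul]
    rw [e1, conj_iff, pow_succ, hcsq]
    have e2 : c⁻¹ * (b * a * b) * c = (c * c * (a * b))⁻¹ * b := by
      rw [mul_inv_rev, mul_inv_rev, mul_inv_rev, ha', hb']
      calc c⁻¹ * (b * a * b) * c = (c⁻¹ * (b * a)) * (b * c) := by simp only [mul_assoc]
        _ = ((b * a) * c⁻¹) * (c⁻¹ * b) := by rw [comm.eq, key]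
        _ = _ := by simp only [mul_assoc]
    rw [e2]

open Classical in
theorem flip_pow (i j : B) (n : ℕ) (x : W) (e : ZMod 2) :
    ((flip cs i * flip cs j) ^ n) (x, e) =
      ((cs.simple i * cs.simple j) ^ n * x * ((cs.simple i * cs.simple j) ^ n)⁻¹,
        e + ∑ l ∈ Finset.range (2 * n),
          if x = ((cs.simple i * cs.simple j) ^ l)⁻¹ * cs.simple j then 1 else 0) := by
  induction n with
  | zero =>
    rw [pow_zero, pow_zero]
    change (x, e) = _
    simp
  | succ n ih =>
    have h1 : ((flip cs i * flip cs j) ^ (n + 1)) (x, e) =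
        flip cs i (flip cs j (((flip cs i * flip cs j) ^ n) (x, e))) := by
      rw [pow_succ']; rfl
    obtain ⟨f1, f2⟩ := flip_aux (cs.simple i) (cs.simple j) x (cs.simple_mul_simple_self i)
      (cs.simple_mul_simple_self j) n
    rw [h1, ih]
    unfold flip
    dsimp only
    refine Prod.ext ?_ ?_
    · dsimp only
      rw [pow_succ', mul_inv_rev, mul_inv_rev, cs.inv_simple, cs.inv_simple]
      simp only [mul_assoc]
    · dsimp only
      rw [show 2 * (n + 1) = 2 * n + 1 + 1 by ring, Finset.sum_range_succ, Finset.sum_range_succ]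
      simp only [f1, f2, add_assoc]

theorem flip_liftable : M.IsLiftable (flip cs) := by
  classical
  intro i j
  funext p
  obtain ⟨x, e⟩ := p
  rw [flip_pow, cs.simple_mul_simple_pow, two_mul, Finset.sum_range_add]
  have : ∀ l, (cs.simple i * cs.simple j) ^ (M i j + l) = (cs.simple i * cs.simple j) ^ l := by
    intro l; rw [pow_add, cs.simple_mul_simple_pow, one_mul]
  simp only [this]
  rw [CharTwo.add_self_eq_zero]
  change _ = (x, e)
  simp

/-- The homomorphism recording inversion parities. -/
noncomputable def flipHom : W →* Function.End (W × ZMod 2) := cs.lift ⟨flip cs, flip_liftable cs⟩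

open Classical in
theorem flipHom_word (ω : List B) (x : W) (e : ZMod 2) :
    flipHom cs (cs.wordProd ω) (x, e) =
      (cs.wordProd ω * x * (cs.wordProd ω)⁻¹, e + ((cs.rightInvSeq ω).count x : ZMod 2)) := by
  induction ω with
  | nil =>
    rw [cs.wordProd_nil, map_one]
    change (x, e) = _
    simp
  | cons i ω ih =>
    have h1 : flipHom cs (cs.wordProd (i :: ω)) (x, e) =
        flip cs i (flipHom cs (cs.wordProd ω) (x, e)) := by
      rw [cs.wordProd_cons, map_mul, flipHom, CoxeterSystem.lift_apply_simple]; rfl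
    rw [h1, ih]
    unfold flip
    dsimp only
    refine Prod.ext ?_ ?_
    · dsimp only
      rw [cs.wordProd_cons, mul_inv_rev, cs.inv_simple]
      simp only [mul_assoc]
    · dsimp only
      rw [CoxeterSystem.rightInvSeq, List.count_cons]
      have : (cs.wordProd ω * x * (cs.wordProd ω)⁻¹ = cs.simple i) ↔
          (cs.wordProd ω)⁻¹ * cs.simple i * cs.wordProd ω = x := by
        constructor
        · intro h; rw [← h]; group
        · rintro rfl; group
      simp only [this, beq_iff_eq]
      push_cast
      rw [add_assoc]

open Classical in
theorem count_leftInvSeq_eq {ω ω' : List B} (h : cs.wordProd ω = cs.wordProd ω') (x : W) :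
    ((cs.leftInvSeq ω).count x : ZMod 2) = ((cs.leftInvSeq ω').count x : ZMod 2) := by
  have key : ∀ ω : List B, ((cs.leftInvSeq ω).count x : ZMod 2) =
      (flipHom cs (cs.wordProd ω)⁻¹ (x, 0)).2 := by
    intro ω
    rw [← cs.wordProd_reverse, flipHom_word, cs.rightInvSeq_reverse, List.count_reverse]
    simp
  rw [key, key, h]

/-- The exchange property. -/
theorem exchange {ω : List B} {i : B} (h : cs.IsLeftDescent (cs.wordProd ω) i) :
    ∃ j, j < ω.length ∧ cs.simple i * cs.wordProd ω = cs.wordProd (ω.eraseIdx j) := by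
  classical
  obtain ⟨ω₁, hr, h1⟩ := cs.exists_isReduced (cs.simple i * cs.wordProd ω)
  have hw : cs.wordProd (i :: ω₁) = cs.wordProd ω := by
    rw [cs.wordProd_cons, ← h1, cs.simple_mul_simple_cancel_left]
  have hred : cs.IsReduced (i :: ω₁) := by
    have h2 := cs.isLeftDescent_iff.mp h
    unfold CoxeterSystem.IsReduced at hr ⊢
    rw [hw, ← h2, h1, hr]; simp
  have hc := count_leftInvSeq_eq cs hw (cs.simple i)
  have hmem : cs.simple i ∈ cs.leftInvSeq (i :: ω₁) := by simp [CoxeterSystem.leftInvSeq]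
  rw [List.count_eq_one_of_mem hred.nodup_leftInvSeq hmem] at hc
  have hmem2 : cs.simple i ∈ cs.leftInvSeq ω := by
    by_contra hn
    rw [List.count_eq_zero_of_not_mem hn] at hc
    simp at hc
  obtain ⟨j, hj, h3⟩ := List.mem_iff_getElem.mp hmem2
  refine ⟨j, by simpa using hj, ?_⟩
  rw [← cs.getD_leftInvSeq_mul_wordProd, List.getD_eq_getElem _ 1 hj, h3]

theorem isReduced_of_nodup {ω : List B} (h : (cs.leftInvSeq ω).Nodup) : cs.IsReduced ω := by
  classical
  obtain ⟨ω₁, hr, h1⟩ := cs.exists_isReduced (cs.wordProd ω)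
  have hsub : cs.leftInvSeq ω ⊆ cs.leftInvSeq ω₁ := by
    intro x hx
    have hc := count_leftInvSeq_eq cs h1 x
    rw [List.count_eq_one_of_mem h hx] at hc
    by_contra hn
    rw [List.count_eq_zero_of_not_mem hn] at hc
    simp at hc
  have hle := (List.subperm_of_subset h hsub).length_le
  simp only [CoxeterSystem.length_leftInvSeq] at hle
  have := cs.length_wordProd_le ω
  unfold CoxeterSystem.IsReduced at hr ⊢
  rw [← h1] at hr
  omega

/-! ### Alternating words -/

/-- The alternating word of length `k` starting with `a`. -/
def alt (a b : B) : ℕ → List B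
  | 0 => []
  | k + 1 => a :: alt b a k

theorem length_alt (a b : B) (k : ℕ) : (alt a b k).length = k := by
  induction k generalizing a b with
  | zero => rfl
  | succ k ih => simp [alt, ih]

theorem alternatingWord_eq_alt (a b : B) (k : ℕ) :
    alternatingWord a b k = if Even k then alt a b k else alt b a k := by
  induction k with
  | zero => rfl
  | succ k ih =>
    rw [alternatingWord_succ', ih]
    by_cases h : Even k
    · simp [h, Nat.even_add_one, alt]
    · simp only [h, Nat.even_add_one, alt]; simp

theorem leftInvSeq_alt (a b : B) (k : ℕ) :
    cs.leftInvSeq (alt a b k) =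
      (List.range k).map (fun l => (cs.simple a * cs.simple b) ^ l * cs.simple a) := by
  induction k generalizing a b with
  | zero => rfl
  | succ k ih =>
    rw [alt, CoxeterSystem.leftInvSeq, ih, List.range_succ_eq_map, List.map_cons, List.map_map,
      List.map_map]
    congr 1
    · simp
    · apply List.map_congr_left
      intro l _
      simp only [Function.comp_apply, MulAut.conj_apply, cs.inv_simple, Nat.succ_eq_add_one]
      rw [← mul_assoc, ← mul_pow_mul, pow_succ]
      simp only [mul_assoc]

theorem isReduced_alt (a b : B) (hab : a ≠ b) (k : ℕ) (hk : M a b = 0 ∨ k ≤ M a b) :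
    cs.IsReduced (alt a b k) := by
  apply isReduced_of_nodup
  rw [leftInvSeq_alt]
  apply List.Nodup.map_on _ List.nodup_range
  have aux : ∀ x y : ℕ, x < y → y < k → (cs.simple a * cs.simple b) ^ x * cs.simple a ≠
      (cs.simple a * cs.simple b) ^ y * cs.simple a := by
    intro x y hxy hy h
    have h := mul_right_cancel h
    apply simple_pow_ne cs a b hab (y - x) (by omega) (by omega)
    have h3 : (cs.simple a * cs.simple b) ^ y =
        (cs.simple a * cs.simple b) ^ x * (cs.simple a * cs.simple b) ^ (y - x) := by
      rw [← pow_add]; congr 1; omega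
    rw [h3] at h
    exact (mul_eq_left.mp h.symm)
  intro x hx y hy h
  rw [List.mem_range] at hx hy
  rcases lt_trichotomy x y with h1 | h1 | h1
  · exact absurd h (aux x y h1 hy)
  · exact h1
  · exact absurd h.symm (aux y x h1 hx)

theorem wordProd_alt_comm (a b : B) :
    cs.wordProd (alt a b (M a b)) = cs.wordProd (alt b a (M a b)) := by
  have h := cs.wordProd_braidWord_eq a b
  simp only [braidWord, M.symmetric b a, alternatingWord_eq_alt] at h
  split_ifs at h
  · exact h
  · exact h.symm

/-! ### Dihedral cosets -/

/-- `(c, d)` is `(a, b)` up to order. -/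
def SamePair (a b c d : B) : Prop := (c = a ∧ d = b) ∨ (c = b ∧ d = a)

theorem SamePair.swap {a b c d : B} (h : SamePair a b c d) : SamePair a b d c := by
  unfold SamePair at *; tauto

theorem SamePair.matrix {a b c d : B} (h : SamePair a b c d) : M c d = M a b := by
  rcases h with ⟨rfl, rfl⟩ | ⟨rfl, rfl⟩
  · rfl
  · exact M.symmetric _ _

theorem SamePair.ne {a b c d : B} (h : SamePair a b c d) (hab : a ≠ b) : c ≠ d := by
  rcases h with ⟨rfl, rfl⟩ | ⟨rfl, rfl⟩
  · exact hab
  · exact hab.symm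

/-- The dihedral parabolic subgroup. -/
def dih (a b : B) : Subgroup W := Subgroup.closure {cs.simple a, cs.simple b}

theorem simple_mem_dih {a b c d : B} (h : SamePair a b c d) : cs.simple c ∈ dih cs a b := by
  apply Subgroup.subset_closure
  rcases h with ⟨rfl, rfl⟩ | ⟨rfl, rfl⟩ <;> simp

theorem alt_mem_dih {a b : B} (k : ℕ) : ∀ {c d : B}, SamePair a b c d →
    cs.wordProd (alt c d k) ∈ dih cs a b := by
  induction k with
  | zero => intro c d _; simp [alt]
  | succ k ih =>
    intro c d h
    rw [alt, cs.wordProd_cons]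
    exact Subgroup.mul_mem _ (simple_mem_dih cs h) (ih h.swap)

theorem simple_mul_alt {a b : B} (hab : a ≠ b) {e c d f : B} (he : SamePair a b e f)
    (hc : SamePair a b c d) (k : ℕ) (hk : M a b = 0 ∨ k ≤ M a b) :
    ∃ c' d' k', SamePair a b c' d' ∧ (M a b = 0 ∨ k' ≤ M a b) ∧
      cs.simple e * cs.wordProd (alt c d k) = cs.wordProd (alt c' d' k') := by
  have hM : M a b ≠ 1 := M.off_diagonal a b hab
  have hec : (e = c ∧ f = d) ∨ (e = d ∧ f = c) := by
    rcases he with ⟨rfl, rfl⟩ | ⟨rfl, rfl⟩ <;> rcases hc with ⟨rfl, rfl⟩ | ⟨rfl, rfl⟩ <;> simp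
  rcases hec with ⟨rfl, rfl⟩ | ⟨rfl, rfl⟩
  · cases k with
    | zero =>
      refine ⟨e, f, 1, hc, by omega, ?_⟩
      simp [alt]
    | succ k =>
      refine ⟨f, e, k, hc.swap, by omega, ?_⟩
      rw [alt, cs.wordProd_cons, cs.simple_mul_simple_cancel_left]
  · by_cases hk' : M a b = 0 ∨ k < M a b
    · refine ⟨e, f, k + 1, he, by omega, ?_⟩
      rw [alt, cs.wordProd_cons]
    · have hkM : k = M f e := by rw [hc.matrix]; omega
      obtain ⟨k', hk1⟩ : ∃ k', k = k' + 1 := ⟨k - 1, by omega⟩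
      refine ⟨f, e, k', hc, by omega, ?_⟩
      have := wordProd_alt_comm cs f e
      rw [← hkM] at this
      rw [this, hk1, alt, cs.wordProd_cons, cs.simple_mul_simple_cancel_left]

theorem exists_alt_of_mem {a b : B} (hab : a ≠ b) {y : W} (hy : y ∈ dih cs a b) :
    ∃ c d k, SamePair a b c d ∧ (M a b = 0 ∨ k ≤ M a b) ∧ y = cs.wordProd (alt c d k) := by
  have hs : ∀ x ∈ ({cs.simple a, cs.simple b} : Set W), ∃ e f, SamePair a b e f ∧
      x = cs.simple e := by
    rintro x (rfl | rfl)
    · exact ⟨a, b, Or.inl ⟨rfl, rfl⟩, rfl⟩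
    · exact ⟨b, a, Or.inr ⟨rfl, rfl⟩, rfl⟩
  induction hy using Subgroup.closure_induction_left with
  | one => exact ⟨a, b, 0, Or.inl ⟨rfl, rfl⟩, by omega, by simp [alt]⟩
  | mul_left x hx y hy ih =>
    obtain ⟨c, d, k, h1, h2, rfl⟩ := ih
    obtain ⟨e, f, h3, rfl⟩ := hs x hx
    exact simple_mul_alt cs hab h3 h1 k h2
  | inv_mul_cancel x hx y hy ih =>
    obtain ⟨c, d, k, h1, h2, rfl⟩ := ih
    obtain ⟨e, f, h3, rfl⟩ := hs x hx
    rw [cs.inv_simple]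
    exact simple_mul_alt cs hab h3 h1 k h2

/-- Minimality in a left dihedral coset. -/
def IsMin (a b : B) (v : W) : Prop := ∀ y ∈ dih cs a b, cs.length v ≤ cs.length (y * v)

theorem length_alt_mul {a b : B} (hab : a ≠ b) {v : W} (hv : IsMin cs a b v) (k : ℕ) :
    ∀ {c d : B}, SamePair a b c d → (M a b = 0 ∨ k ≤ M a b) →
      cs.length (cs.wordProd (alt c d k) * v) = k + cs.length v := by
  induction k with
  | zero => intro c d _ _; simp [alt]
  | succ k ih =>
    intro c d hc hk
    have h1 := ih hc.swap (by omega)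
    rw [alt, cs.wordProd_cons, mul_assoc]
    rcases cs.length_simple_mul (cs.wordProd (alt d c k) * v) c with h | h
    · omega
    exfalso
    obtain ⟨ω, hr, rfl⟩ := cs.exists_isReduced v
    rw [← cs.wordProd_append] at h
    have hd : cs.IsLeftDescent (cs.wordProd (alt d c k ++ ω)) c := by
      unfold CoxeterSystem.IsLeftDescent; omega
    obtain ⟨j, hj, h2⟩ := exchange cs hd
    rw [List.length_append, length_alt] at hj
    rcases Nat.lt_or_ge j k with hjk | hjk
    · rw [List.eraseIdx_append_of_lt_length (by rwa [length_alt]), cs.wordProd_append,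
        cs.wordProd_append, ← mul_assoc] at h2
      have h3 := mul_right_cancel h2
      have h4 : cs.IsReduced (alt c d (k + 1)) :=
        isReduced_alt cs c d (hc.ne hab) (k + 1) (by rw [hc.matrix]; exact hk)
      unfold CoxeterSystem.IsReduced at h4
      rw [alt, cs.wordProd_cons, h3] at h4
      have h5 := cs.length_wordProd_le ((alt d c k).eraseIdx j)
      rw [List.length_eraseIdx_of_lt (by rwa [length_alt])] at h5
      simp only [List.length_cons, length_alt] at h4 h5
      omega
    · rw [List.eraseIdx_append_of_length_le (by rwa [length_alt]), cs.wordProd_append,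
        cs.wordProd_append, length_alt] at h2
      set P := cs.wordProd (alt d c k) with hP
      have hPm : P ∈ dih cs a b := alt_mem_dih cs k hc.swap
      have h3 := hv (P⁻¹ * cs.simple c * P)
        (Subgroup.mul_mem _ (Subgroup.mul_mem _ (Subgroup.inv_mem _ hPm) (simple_mem_dih cs hc)) hPm)
      have h4 : P⁻¹ * cs.simple c * P * cs.wordProd ω = cs.wordProd (ω.eraseIdx (j - k)) := by
        rw [mul_assoc, mul_assoc, h2, inv_mul_cancel_left]
      rw [h4] at h3
      have h5 := cs.length_wordProd_le (ω.eraseIdx (j - k))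
      rw [List.length_eraseIdx_of_lt (by omega)] at h5
      unfold CoxeterSystem.IsReduced at hr
      omega

theorem exists_decomp {a b : B} (hab : a ≠ b) (w : W) :
    ∃ c d k v, SamePair a b c d ∧ (M a b = 0 ∨ k ≤ M a b) ∧ IsMin cs a b v ∧
      w = cs.wordProd (alt c d k) * v := by
  have hne : {v : W | ∃ y ∈ dih cs a b, w = y * v}.Nonempty := ⟨w, 1, Subgroup.one_mem _, by simp⟩
  obtain ⟨v, ⟨y, hy, hw⟩, hmin⟩ := (measure cs.length).wf.has_min _ hne
  obtain ⟨c, d, k, h1, h2, rfl⟩ := exists_alt_of_mem cs hab hy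
  refine ⟨c, d, k, v, h1, h2, ?_, hw⟩
  intro z hz
  have := hmin (z * v) ⟨cs.wordProd (alt c d k) * z⁻¹,
    Subgroup.mul_mem _ hy (Subgroup.inv_mem _ hz), by rw [hw]; group⟩
  exact not_lt.mp this

theorem isMin_of_not_descent {a b : B} (hab : a ≠ b) {w : W} (ha : ¬ cs.IsLeftDescent w a)
    (hb : ¬ cs.IsLeftDescent w b) : IsMin cs a b w := by
  obtain ⟨c, d, k, v, h1, h2, h3, rfl⟩ := exists_decomp cs hab w
  cases k with
  | zero => simpa [alt] using h3
  | succ k =>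
    exfalso
    have hc : cs.IsLeftDescent (cs.wordProd (alt c d (k + 1)) * v) c := by
      unfold CoxeterSystem.IsLeftDescent
      rw [length_alt_mul cs hab h3 (k + 1) h1 h2, alt, cs.wordProd_cons, mul_assoc,
        cs.simple_mul_simple_cancel_left, length_alt_mul cs hab h3 k h1.swap (by omega)]
      omega
    rcases h1 with ⟨rfl, rfl⟩ | ⟨rfl, rfl⟩
    · exact ha hc
    · exact hb hc

theorem descent_pair {a b : B} (hab : a ≠ b) {w : W} (ha : cs.IsLeftDescent w a)
    (hb : cs.IsLeftDescent w b) : M a b ≠ 0 ∧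
      ∃ v, w = cs.wordProd (alt a b (M a b)) * v ∧ cs.length w = M a b + cs.length v := by
  obtain ⟨c, d, k, v, h1, h2, h3, rfl⟩ := exists_decomp cs hab w
  have hl := length_alt_mul cs hab h3 k h1 h2
  have hd : cs.IsLeftDescent (cs.wordProd (alt c d k) * v) d := by
    rcases h1 with ⟨rfl, rfl⟩ | ⟨rfl, rfl⟩
    · exact hb
    · exact ha
  have hk : M a b ≠ 0 ∧ k = M a b := by
    by_contra hn
    have h4 := length_alt_mul cs hab h3 (k + 1) h1.swap (by omega)
    rw [alt, cs.wordProd_cons, mul_assoc] at h4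
    unfold CoxeterSystem.IsLeftDescent at hd
    omega
  refine ⟨hk.1, v, ?_, by rw [hl, hk.2]⟩
  rw [hk.2]
  rcases h1 with ⟨rfl, rfl⟩ | ⟨rfl, rfl⟩
  · rfl
  · rw [wordProd_alt_comm]

theorem reverse_alt (a b : B) (k : ℕ) : (alt a b k).reverse = alternatingWord b a k := by
  induction k generalizing a b with
  | zero => rfl
  | succ k ih => rw [alt, List.reverse_cons, ih, alternatingWord_succ, List.concat_eq_append]

theorem inv_alt (a b : B) :
    (cs.wordProd (alt a b (M a b)))⁻¹ = cs.wordProd (alt a b (M a b)) := by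
  rw [← cs.wordProd_reverse, reverse_alt, alternatingWord_eq_alt]
  split_ifs
  · rw [wordProd_alt_comm]
  · rfl

theorem length_mul_alt {a b : B} (hab : a ≠ b) {w : W} (ha : ¬ cs.IsRightDescent w a)
    (hb : ¬ cs.IsRightDescent w b) :
    cs.length (w * cs.wordProd (alt a b (M a b))) = cs.length w + M a b := by
  rw [← cs.isLeftDescent_inv_iff] at ha hb
  have := length_alt_mul cs hab (isMin_of_not_descent cs hab ha hb) (M a b) (Or.inl ⟨rfl, rfl⟩)
    (Or.inr le_rfl)
  rw [← cs.length_inv, mul_inv_rev, inv_alt, this, cs.length_inv, add_comm]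

/-! ### Newman's lemma -/

open Relation in
theorem newman {X : Type*} (step : X → X → Prop) (len : X → ℕ) (N : ℕ)
    (h1 : ∀ x y, step x y → len x < len y) (h2 : ∀ x y, step x y → len y ≤ N)
    (conf : ∀ v a b, step v a → step v b →
      ∃ z, ReflTransGen step a z ∧ ReflTransGen step b z) (v : X) :
    ∃ m, ReflTransGen step v m ∧ ∀ x, ReflTransGen step v x → ReflTransGen step x m := by
  induction hn : N - len v using Nat.strong_induction_on generalizing v with
  | _ n ih =>
    by_cases hv : ∃ a, step v a
    · have hdec : ∀ a, step v a → N - len a < n := by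
        intro a ha
        have := h1 _ _ ha
        have := h2 _ _ ha
        omega
      obtain ⟨a, ha⟩ := hv
      obtain ⟨m, hm1, hm2⟩ := ih _ (hdec a ha) a rfl
      refine ⟨m, ReflTransGen.head ha hm1, ?_⟩
      intro x hx
      rcases ReflTransGen.cases_head hx with rfl | ⟨b, hb, hbx⟩
      · exact ReflTransGen.head ha hm1
      · obtain ⟨m', hm1', hm2'⟩ := ih _ (hdec b hb) b rfl
        obtain ⟨z, hz1, hz2⟩ := conf v a b ha hb
        exact (hm2' x hbx).trans (hm2 m' (hz1.trans (hm2' z hz2)))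
    · refine ⟨v, ReflTransGen.refl, ?_⟩
      intro x hx
      rcases ReflTransGen.cases_head hx with rfl | ⟨b, hb, _⟩
      · exact ReflTransGen.refl
      · exact absurd ⟨b, hb⟩ hv

/-! ### The weak order -/

/-- Prefix order on `W`. -/
def Pre (v w : W) : Prop := cs.length v + cs.length (v⁻¹ * w) = cs.length w

theorem Pre.refl (v : W) : Pre cs v v := by simp [Pre]

theorem one_pre (v : W) : Pre cs 1 v := by simp [Pre]

theorem length_tri (u v w : W) :
    cs.length (u⁻¹ * w) ≤ cs.length (u⁻¹ * v) + cs.length (v⁻¹ * w) := by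
  have := cs.length_mul_le (u⁻¹ * v) (v⁻¹ * w)
  rwa [show u⁻¹ * v * (v⁻¹ * w) = u⁻¹ * w by group] at this

theorem length_tri_one (v w : W) : cs.length w ≤ cs.length v + cs.length (v⁻¹ * w) := by
  have := length_tri cs 1 v w
  simpa using this

variable {cs}

theorem Pre.add {u v w : W} (h1 : Pre cs u v) (h2 : Pre cs v w) :
    cs.length (u⁻¹ * w) = cs.length (u⁻¹ * v) + cs.length (v⁻¹ * w) := by
  have := length_tri cs u v w
  have := length_tri_one cs u w
  unfold Pre at *
  omega

theorem Pre.trans {u v w : W} (h1 : Pre cs u v) (h2 : Pre cs v w) : Pre cs u w := by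
  have := h1.add h2
  unfold Pre at *
  omega

theorem Pre.antisymm {u v : W} (h1 : Pre cs u v) (h2 : Pre cs v u) : u = v := by
  unfold Pre at *
  have : cs.length (u⁻¹ * v) = 0 := by omega
  rw [cs.length_eq_zero_iff] at this
  exact inv_mul_eq_one.mp this

theorem Pre.descent {v w : W} (h : Pre cs v w) {s : B} (hs : cs.IsLeftDescent v s) :
    cs.IsLeftDescent w s := by
  unfold CoxeterSystem.IsLeftDescent at *
  have := cs.length_mul_le (cs.simple s * v) (v⁻¹ * w)
  rw [show cs.simple s * v * (v⁻¹ * w) = cs.simple s * w by group] at this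
  unfold Pre at h
  omega

variable (cs)

/-- The set of prefixes of `w` avoiding the left descent `s`. -/
def Avoid (s : B) (w x : W) : Prop := Pre cs x w ∧ ¬ cs.IsLeftDescent x s

/-- Covering steps in `Avoid`. -/
def AvoidStep (s : B) (w v a : W) : Prop :=
  Avoid cs s w v ∧ Avoid cs s w a ∧ ∃ i, a = v * cs.simple i ∧ cs.length a = cs.length v + 1

theorem avoid_path (s : B) (w : W) (n : ℕ) : ∀ v y : W, cs.length (v⁻¹ * y) = n →
    Avoid cs s w v → Avoid cs s w y → Pre cs v y →
      Relation.ReflTransGen (AvoidStep cs s w) v y := by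
  induction n with
  | zero =>
    intro v y h _ _ _
    rw [cs.length_eq_zero_iff, inv_mul_eq_one] at h
    rw [h]
  | succ n ih =>
    intro v y h hv hy hvy
    have hne : v⁻¹ * y ≠ 1 := by
      intro h1; rw [h1, cs.length_one] at h; omega
    obtain ⟨i, hi⟩ := cs.exists_leftDescent_of_ne_one hne
    rw [cs.isLeftDescent_iff] at hi
    have e : (v * cs.simple i)⁻¹ * y = cs.simple i * (v⁻¹ * y) := by
      rw [mul_inv_rev, cs.inv_simple, mul_assoc]
    have h1 : cs.length ((v * cs.simple i)⁻¹ * y) = n := by rw [e]; omega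
    have h2 := length_tri_one cs (v * cs.simple i) y
    have h3 := cs.length_mul_le v (cs.simple i)
    rw [cs.length_simple] at h3
    have h4 : cs.length (v * cs.simple i) = cs.length v + 1 := by unfold Pre at hvy; omega
    have h5 : Pre cs (v * cs.simple i) y := by unfold Pre at *; omega
    have h6 : Avoid cs s w (v * cs.simple i) :=
      ⟨h5.trans hy.1, fun hd => hy.2 (h5.descent hd)⟩
    exact Relation.ReflTransGen.head ⟨hv, h6, i, rfl, h4⟩ (ih _ _ h1 h6 hy h5)

theorem avoidStep_pre {s : B} {w v a : W} (h : AvoidStep cs s w v a) : Pre cs v a := by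
  obtain ⟨_, _, i, rfl, h⟩ := h
  unfold Pre
  rw [h, inv_mul_cancel_left, cs.length_simple]

theorem exists_max_avoid (s : B) (w : W) :
    ∃ v, Avoid cs s w v ∧ ∀ x, Avoid cs s w x → Pre cs x v := by
  have hpre : ∀ x y, Relation.ReflTransGen (AvoidStep cs s w) x y → Pre cs x y := by
    intro x y h
    induction h with
    | refl => exact Pre.refl cs x
    | tail _ h2 ih => exact ih.trans (avoidStep_pre cs h2)
  have hone : Avoid cs s w 1 := ⟨one_pre cs w, cs.not_isLeftDescent_one s⟩
  obtain ⟨m, hm1, hm2⟩ := newman (AvoidStep cs s w) cs.length (cs.length w)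
    (fun x y h => by obtain ⟨_, _, i, _, h⟩ := h; omega)
    (fun x y h => by have := h.2.1.1; unfold Pre at this; omega)
    (by
      rintro v a b ⟨hv, ha, i, rfl, hai⟩ ⟨_, hb, j, rfl, hbj⟩
      by_cases hij : i = j
      · subst hij
        exact ⟨_, Relation.ReflTransGen.refl, Relation.ReflTransGen.refl⟩
      have desc : ∀ k, Avoid cs s w (v * cs.simple k) →
          cs.length (v * cs.simple k) = cs.length v + 1 → cs.IsLeftDescent (v⁻¹ * w) k := by
        intro k hk hk1
        have h1 := hk.1
        have h2 := hv.1
        unfold Pre at h1 h2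
        rw [mul_inv_rev, cs.inv_simple, mul_assoc] at h1
        unfold CoxeterSystem.IsLeftDescent
        omega
      obtain ⟨hM, u, hu, hlu⟩ := descent_pair cs hij (desc i ha hai) (desc j hb hbj)
      set z := v * cs.wordProd (alt i j (M i j)) with hz
      have hzw : z⁻¹ * w = u := by
        rw [hz, mul_inv_rev, mul_assoc, hu, inv_mul_cancel_left]
      have hle := cs.length_mul_le v (cs.wordProd (alt i j (M i j)))
      rw [← hz] at hle
      have hle2 := cs.length_wordProd_le (alt i j (M i j))
      rw [length_alt] at hle2
      have htri := length_tri_one cs z w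
      have hvw := hv.1
      unfold Pre at hvw
      rw [hzw] at htri
      have hlz : cs.length z = cs.length v + M i j := by omega
      have hzp : Pre cs z w := by unfold Pre; rw [hzw]; omega
      obtain ⟨m, hm⟩ : ∃ m, M i j = m + 1 := ⟨M i j - 1, by omega⟩
      have hp : ∀ k l, cs.wordProd (alt i j (M i j)) = cs.wordProd (alt k l (M i j)) →
          cs.length (v * cs.simple k) = cs.length v + 1 → Pre cs (v * cs.simple k) z := by
        intro k l hkl hk
        have e : (v * cs.simple k)⁻¹ * z = cs.wordProd (alt l k m) := by
          rw [hz, hkl, hm, alt, cs.wordProd_cons, mul_inv_rev, mul_assoc, inv_mul_cancel_left,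
            inv_mul_cancel_left]
        have h1 := cs.length_wordProd_le (alt l k m)
        rw [length_alt] at h1
        have h2 := length_tri_one cs (v * cs.simple k) z
        rw [e] at h2
        unfold Pre
        rw [e]
        omega
      have hrd : ∀ k, Avoid cs s w (v * cs.simple k) →
          cs.length (v * cs.simple k) = cs.length v + 1 →
          ¬ cs.IsRightDescent (cs.simple s * v) k := by
        intro k hk hk1 hd
        apply hk.2
        have hv2 := cs.not_isLeftDescent_iff.mp hv.2
        unfold CoxeterSystem.IsRightDescent at hd
        unfold CoxeterSystem.IsLeftDescent
        rw [← mul_assoc]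
        omega
      have hlen := length_mul_alt cs hij (hrd i ha hai) (hrd j hb hbj)
      rw [mul_assoc, ← hz] at hlen
      have hza : Avoid cs s w z := by
        refine ⟨hzp, ?_⟩
        have hv2 := cs.not_isLeftDescent_iff.mp hv.2
        unfold CoxeterSystem.IsLeftDescent
        omega
      exact ⟨z, avoid_path cs s w _ _ _ rfl ha hza (hp i j rfl hai),
        avoid_path cs s w _ _ _ rfl hb hza (hp j i (wordProd_alt_comm cs i j) hbj)⟩) 1
  refine ⟨m, ?_, ?_⟩
  · rcases Relation.ReflTransGen.cases_tail hm1 with h | ⟨_, _, h⟩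
    · rw [h]; exact hone
    · exact h.2.1
  · intro x hx
    exact hpre _ _ (hm2 x (avoid_path cs s w _ _ _ rfl hone hx (one_pre cs x)))

/-! ### The braid monoid -/

variable (M) in
/-- The class of a word in the braid monoid. -/
def mkw (ω : List B) : M.BraidMonoid := PresentedMonoid.mk M.braidRels (FreeMonoid.ofList ω)

theorem mkw_nil : mkw M [] = 1 := rfl

theorem mkw_append (ω ω' : List B) : mkw M (ω ++ ω') = mkw M ω * mkw M ω' := rfl

theorem mkw_cons (i : B) (ω : List B) : mkw M (i :: ω) = mkw M [i] * mkw M ω := rfl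

theorem exists_mkw (b : M.BraidMonoid) : ∃ ω, b = mkw M ω := by
  obtain ⟨x, hx⟩ := PresentedMonoid.surjective_mk (rels := M.braidRels) b
  exact ⟨FreeMonoid.toList x, hx.symm⟩

theorem mkw_alt_comm (a b : B) : mkw M (alt a b (M a b)) = mkw M (alt b a (M a b)) := by
  have h : mkw M (alternatingWord a b (M a b)) = mkw M (alternatingWord b a (M a b)) :=
    PresentedMonoid.mk_eq_mk_of_rel ⟨a, b, rfl, rfl⟩
  rw [alternatingWord_eq_alt, alternatingWord_eq_alt] at h
  split_ifs at h
  · exact h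
  · exact h.symm

/-- The universal property of the braid monoid. -/
theorem exists_lift {N : Type*} [Monoid N] (f : B → N)
    (h : ∀ a b, ((alt a b (M a b)).map f).prod = ((alt b a (M a b)).map f).prod) :
    ∃ φ : M.BraidMonoid →* N, ∀ ω, φ (mkw M ω) = (ω.map f).prod := by
  have hrel : ∀ a b : FreeMonoid B, M.braidRels a b →
      FreeMonoid.lift f a = FreeMonoid.lift f b := by
    rintro _ _ ⟨i, j, rfl, rfl⟩
    rw [FreeMonoid.lift_ofList, FreeMonoid.lift_ofList, alternatingWord_eq_alt,
      alternatingWord_eq_alt]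
    split_ifs
    · exact h i j
    · exact (h i j).symm
  refine ⟨PresentedMonoid.lift f hrel, ?_⟩
  intro ω
  exact FreeMonoid.lift_ofList f ω

/-- Matsumoto's theorem. -/
theorem matsumoto (n : ℕ) : ∀ ω ω' : List B, ω.length = n → cs.IsReduced ω → cs.IsReduced ω' →
    cs.wordProd ω = cs.wordProd ω' → mkw M ω = mkw M ω' := by
  induction n with
  | zero =>
    intro ω ω' h hr hr' he
    have : ω'.length = 0 := by
      unfold CoxeterSystem.IsReduced at hr hr'
      rw [he] at hr; omega
    rw [List.length_eq_zero_iff] at h this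
    rw [h, this]
  | succ n ih =>
    intro ω ω' h hr hr' he
    have hl' : ω'.length = n + 1 := by
      unfold CoxeterSystem.IsReduced at hr hr'
      rw [he] at hr; omega
    match ω, h, hr, ω', hl', hr', he with
    | a :: u, h, hr, b :: u', hl', hr', he =>
      have hru : cs.IsReduced u := hr.drop 1
      have hru' : cs.IsReduced u' := hr'.drop 1
      simp only [List.length_cons, Nat.add_right_cancel_iff] at h hl'
      by_cases hab : a = b
      · subst hab
        rw [cs.wordProd_cons, cs.wordProd_cons] at he
        rw [mkw_cons, mkw_cons a u', ih u u' h hru hru' (mul_left_cancel he)]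
      · have hda : cs.IsLeftDescent (cs.wordProd (a :: u)) a := by
          unfold CoxeterSystem.IsLeftDescent
          rw [hr.eq, cs.wordProd_cons, cs.simple_mul_simple_cancel_left, hru.eq]
          simp
        have hdb : cs.IsLeftDescent (cs.wordProd (a :: u)) b := by
          unfold CoxeterSystem.IsLeftDescent
          rw [he, hr'.eq, cs.wordProd_cons, cs.simple_mul_simple_cancel_left, hru'.eq]
          simp
        obtain ⟨hM, v, hv, hlv⟩ := descent_pair cs hab hda hdb
        obtain ⟨x, hx, rfl⟩ := cs.exists_isReduced v
        obtain ⟨m, hm⟩ : ∃ m, M a b = m + 1 := ⟨M a b - 1, by omega⟩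
        have hlen : n = m + x.length := by
          rw [hr.eq, hx.eq, List.length_cons] at hlv; omega
        -- words starting with `c` are equivalent to the alternating word followed by `x`
        have key : ∀ c d (y : List B), y.length = n → cs.IsReduced y →
            cs.wordProd (c :: y) = cs.wordProd (alt c d (M a b)) * cs.wordProd x →
            mkw M (c :: y) = mkw M (alt c d (M a b)) * mkw M x := by
          intro c d y hy hyr hye
          have h1 : cs.wordProd y = cs.wordProd (alt d c m ++ x) := by
            rw [hm, alt, cs.wordProd_cons, cs.wordProd_cons, mul_assoc] at hye
            rw [cs.wordProd_append]
            exact mul_left_cancel hye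
          have h2 : cs.IsReduced (alt d c m ++ x) := by
            unfold CoxeterSystem.IsReduced at hyr ⊢
            rw [← h1, hyr, List.length_append, length_alt, hy, hlen]
          rw [mkw_cons, ih y _ hy hyr h2 h1, hm, alt, mkw_cons c (alt d c m), mkw_append, mul_assoc]
        rw [key a b u h hru hv, key b a u' hl' hru' (by rw [← he, hv, wordProd_alt_comm]),
          mkw_alt_comm]

/-- The canonical section from the Coxeter group to the braid monoid. -/
noncomputable def sec (w : W) : M.BraidMonoid := mkw M (cs.exists_isReduced w).choose

theorem sec_word {ω : List B} (h : cs.IsReduced ω) : sec cs (cs.wordProd ω) = mkw M ω := by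
  have hs := (cs.exists_isReduced (cs.wordProd ω)).choose_spec
  exact matsumoto cs _ _ _ rfl hs.1 h hs.2.symm

theorem sec_mul {v u : W} (h : cs.length (v * u) = cs.length v + cs.length u) :
    sec cs (v * u) = sec cs v * sec cs u := by
  obtain ⟨x, hx, rfl⟩ := cs.exists_isReduced v
  obtain ⟨y, hy, rfl⟩ := cs.exists_isReduced u
  rw [sec_word cs hx, sec_word cs hy, ← mkw_append, ← cs.wordProd_append, sec_word]
  unfold CoxeterSystem.IsReduced at *
  rw [cs.wordProd_append, h, hx, hy, List.length_append]

theorem sec_one : sec cs (1 : W) = 1 := by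
  have : cs.IsReduced [] := by simp [CoxeterSystem.IsReduced]
  have h := sec_word cs this
  rwa [cs.wordProd_nil] at h

theorem sec_simple (i : B) : sec cs (cs.simple i) = mkw M [i] := by
  have : cs.IsReduced [i] := by simp [CoxeterSystem.IsReduced]
  have h := sec_word cs this
  rwa [cs.wordProd_singleton] at h

theorem sec_pre {v w : W} (h : Pre cs v w) : sec cs w = sec cs v * sec cs (v⁻¹ * w) := by
  rw [← sec_mul, mul_inv_cancel_left]
  rw [mul_inv_cancel_left]; exact h.symm

/-- The maximal prefix of `w` avoiding `s`. -/
noncomputable def vmax (s : B) (w : W) : W := (exists_max_avoid cs s w).choose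

theorem vmax_avoid (s : B) (w : W) : Avoid cs s w (vmax cs s w) :=
  (exists_max_avoid cs s w).choose_spec.1

theorem vmax_max (s : B) (w : W) {x : W} (hx : Avoid cs s w x) : Pre cs x (vmax cs s w) :=
  (exists_max_avoid cs s w).choose_spec.2 x hx

/-- The action of generators on pairs (head, tail). -/
noncomputable def act (s : B) : Function.End (W × M.BraidMonoid) := fun p =>
  (cs.simple s * vmax cs s p.1, sec cs ((vmax cs s p.1)⁻¹ * p.1) * p.2)

theorem act_word (w : W) (r : M.BraidMonoid) (ω : List B) (hω : cs.IsReduced ω) :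
    ∃ v, (ω.map (act cs)).prod (w, r) = (cs.wordProd ω * v, sec cs (v⁻¹ * w) * r) ∧
      Pre cs v w ∧ cs.length (cs.wordProd ω * v) = cs.length (cs.wordProd ω) + cs.length v ∧
      ∀ x, Pre cs x w → cs.length (cs.wordProd ω * x) = cs.length (cs.wordProd ω) + cs.length x →
        Pre cs x v := by
  induction ω with
  | nil =>
    refine ⟨w, ?_, Pre.refl cs w, by simp, fun x hx _ => hx⟩
    change (w, r) = _
    simp [sec_one]
  | cons s p ih =>
    have hp : cs.IsReduced p := hω.drop 1
    obtain ⟨v, h1, h2, h3, h4⟩ := ih hp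
    have hlen : cs.length (cs.simple s * cs.wordProd p) = cs.length (cs.wordProd p) + 1 := by
      rw [← cs.wordProd_cons, hω.eq, hp.eq, List.length_cons]
    set P := cs.wordProd p with hP
    have hPa : Avoid cs s (P * v) P := by
      refine ⟨?_, ?_⟩
      · unfold Pre; rw [inv_mul_cancel_left, h3]
      · rw [cs.not_isLeftDescent_iff, hlen]
    have hq := vmax_avoid cs s (P * v)
    have hPq := vmax_max cs s (P * v) hPa
    have hmax := fun x => vmax_max cs s (P * v) (x := x)
    have hact : ((s :: p).map (act cs)).prod (w, r) = act cs s ((p.map (act cs)).prod (w, r)) := by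
      rw [List.map_cons, List.prod_cons]; rfl
    rw [hact, h1]
    unfold act
    dsimp only
    generalize vmax cs s (P * v) = q at hq hPq hmax
    obtain ⟨v', rfl⟩ : ∃ v', q = P * v' := ⟨P⁻¹ * q, by group⟩
    have e1 : (P * v')⁻¹ * (P * v) = v'⁻¹ * v := by group
    have hlq : cs.length (P * v') = cs.length P + cs.length v' := by
      unfold Pre at hPq; rw [inv_mul_cancel_left] at hPq; exact hPq.symm
    have hvv : Pre cs v' v := by
      have := hq.1
      unfold Pre at this ⊢
      rw [e1] at this
      omega
    have hns := cs.not_isLeftDescent_iff.mp hq.2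
    refine ⟨v', ?_, hvv.trans h2, ?_, ?_⟩
    · rw [e1, cs.wordProd_cons, mul_assoc, ← mul_assoc (sec cs _), ← sec_mul]
      · congr 3
        group
      · rw [show v'⁻¹ * v * (v⁻¹ * w) = v'⁻¹ * w by group]
        exact hvv.add h2
    · rw [cs.wordProd_cons, mul_assoc, hns, hlq, hlen]; ring
    · intro x hx hxl
      rw [cs.wordProd_cons, ← hP, hlen, mul_assoc] at hxl
      have h5 := cs.length_mul_le P x
      have h6 := cs.length_simple_mul (P * x) s
      have h7 : cs.length (P * x) = cs.length P + cs.length x := by omega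
      have hxv := h4 x hx h7
      have hpx : Avoid cs s (P * v) (P * x) := by
        refine ⟨?_, ?_⟩
        · unfold Pre at hxv ⊢
          rw [show (P * x)⁻¹ * (P * v) = x⁻¹ * v by group]
          omega
        · rw [cs.not_isLeftDescent_iff]; omega
      have h8 := hmax _ hpx
      unfold Pre at h8 ⊢
      rw [show (P * x)⁻¹ * (P * v') = x⁻¹ * v' by group] at h8
      omega

theorem act_braid (a b : B) :
    ((alt a b (M a b)).map (act cs)).prod = ((alt b a (M a b)).map (act cs)).prod := by
  by_cases hab : a = b
  · subst hab; rfl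
  by_cases hM : M a b = 0
  · rw [hM]; rfl
  funext p
  obtain ⟨w, r⟩ := p
  obtain ⟨v, h1, h2, h3, h4⟩ := act_word cs w r _ (isReduced_alt cs a b hab _ (Or.inr le_rfl))
  obtain ⟨v', h1', h2', h3', h4'⟩ := act_word cs w r (alt b a (M a b))
    (isReduced_alt cs b a (Ne.symm hab) _ (Or.inr (M.symmetric a b).le))
  rw [h1, h1']
  rw [← wordProd_alt_comm] at h3' h4' ⊢
  have : v = v' := (h4' v h2 h3).antisymm (h4 v' h2' h3')
  rw [this]

/-- Existence of the (head, tail) normal form map. -/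
theorem exists_normal : ∃ N : M.BraidMonoid → W × M.BraidMonoid,
    (∀ i b, N (mkw M [i] * b) = act cs i (N b)) ∧ ∀ b, b = sec cs (N b).1 * (N b).2 := by
  obtain ⟨φ, hφ⟩ := exists_lift (M := M) (act cs) (act_braid cs)
  have hcons : ∀ i b, φ (mkw M [i] * b) (1, 1) = act cs i (φ b (1, 1)) := by
    intro i b
    rw [map_mul, hφ]
    simp only [List.map_cons, List.map_nil, List.prod_cons, List.prod_nil, mul_one]
    rfl
  refine ⟨fun b => φ b (1, 1), hcons, ?_⟩
  intro b
  obtain ⟨ω, rfl⟩ := exists_mkw b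
  induction ω with
  | nil =>
    have h1 : φ (mkw M []) (1, 1) = ((1 : W), (1 : M.BraidMonoid)) := by
      rw [hφ]; rfl
    dsimp only
    rw [h1, sec_one, mul_one, mkw_nil]
  | cons i ω ih =>
    dsimp only at ih ⊢
    rw [mkw_cons, hcons]
    generalize φ (mkw M ω) (1, 1) = p at ih
    have hv := vmax_avoid cs i p.1
    unfold act
    dsimp only
    have hl := cs.not_isLeftDescent_iff.mp hv.2
    rw [sec_mul cs (by rw [hl, cs.length_simple, add_comm]), sec_simple, mul_assoc,
      ← mul_assoc (sec cs _), ← sec_pre cs hv.1, ← ih]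

theorem cancel_gen (i : B) {x y : M.BraidMonoid} (h : mkw M [i] * x = mkw M [i] * y) : x = y := by
  obtain ⟨N, h1, h2⟩ := exists_normal M.toCoxeterSystem
  have h3 := h1 i x
  rw [h, h1 i y] at h3
  unfold act at h3
  rw [Prod.mk.injEq] at h3
  have e := mul_left_cancel h3.1
  have key : ∀ z : M.BraidMonoid, z = sec M.toCoxeterSystem (vmax M.toCoxeterSystem i (N z).1) *
      (sec M.toCoxeterSystem ((vmax M.toCoxeterSystem i (N z).1)⁻¹ * (N z).1) * (N z).2) := by
    intro z
    rw [← mul_assoc, ← sec_pre _ (vmax_avoid _ i (N z).1).1, ← h2 z]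
  rw [key x, key y, ← h3.2, e]

theorem cancel {x y z : M.BraidMonoid} (h : z * x = z * y) : x = y := by
  obtain ⟨ω, rfl⟩ := exists_mkw z
  induction ω with
  | nil => simpa [mkw_nil] using h
  | cons i ω ih =>
    rw [mkw_cons, mul_assoc, mul_assoc] at h
    exact ih (cancel_gen i h)

theorem lcm_gen {a b : B} (hab : a ≠ b) {x : M.BraidMonoid} (ha : mkw M [a] ∣ x)
    (hb : mkw M [b] ∣ x) : M a b ≠ 0 ∧ mkw M (alt a b (M a b)) ∣ x := by
  obtain ⟨N, h1, h2⟩ := exists_normal M.toCoxeterSystem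
  have hd : ∀ i, mkw M [i] ∣ x → M.toCoxeterSystem.IsLeftDescent (N x).1 i := by
    rintro i ⟨y, rfl⟩
    rw [h1]
    unfold act
    dsimp only
    have := M.toCoxeterSystem.not_isLeftDescent_iff.mp
      (vmax_avoid M.toCoxeterSystem i (N y).1).2
    unfold CoxeterSystem.IsLeftDescent
    rw [M.toCoxeterSystem.simple_mul_simple_cancel_left]
    omega
  obtain ⟨hM, v, hv, hl⟩ := descent_pair M.toCoxeterSystem hab (hd a ha) (hd b hb)
  refine ⟨hM, sec M.toCoxeterSystem v * (N x).2, ?_⟩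
  have hr := isReduced_alt M.toCoxeterSystem a b hab (M a b) (Or.inr le_rfl)
  rw [← sec_word _ hr, ← mul_assoc, ← sec_mul, ← hv, ← h2]
  rw [← hv, hl, hr.eq, length_alt]

theorem exists_length (M : CoxeterMatrix B) :
    ∃ L : M.BraidMonoid → ℕ, (∀ x y, L (x * y) = L x + L y) ∧ ∀ i, L (mkw M [i]) = 1 := by
  obtain ⟨φ, hφ⟩ := exists_lift (M := M) (fun _ => Multiplicative.ofAdd 1) (by
    intro a b
    simp only [List.map_const', List.prod_replicate, length_alt])
  refine ⟨fun x => (φ x).toAdd, ?_, ?_⟩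
  · intro x y; simp
  · intro i; simp [hφ]

/-- One step among common left divisors. -/
def DivStep (b₁ b₂ x y : M.BraidMonoid) : Prop :=
  (y ∣ b₁ ∧ y ∣ b₂) ∧ ∃ i, y = x * mkw M [i]

theorem div_path (b₁ b₂ : M.BraidMonoid) (ω : List B) : ∀ x : M.BraidMonoid,
    (x * mkw M ω ∣ b₁ ∧ x * mkw M ω ∣ b₂) →
      Relation.ReflTransGen (DivStep b₁ b₂) x (x * mkw M ω) := by
  induction ω with
  | nil => intro x _; rw [mkw_nil, mul_one]
  | cons i ω ih =>
    intro x h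
    rw [mkw_cons, ← mul_assoc] at h ⊢
    refine Relation.ReflTransGen.head ⟨?_, i, rfl⟩ (ih _ h)
    exact ⟨(dvd_mul_right _ _).trans h.1, (dvd_mul_right _ _).trans h.2⟩

theorem gcd_exists (b₁ b₂ : M.BraidMonoid) : ∃ g : M.BraidMonoid, (g ∣ b₁ ∧ g ∣ b₂) ∧
      ∀ a : M.BraidMonoid, a ∣ b₁ → a ∣ b₂ → a ∣ g := by
  obtain ⟨L, hL, hL1⟩ := exists_length M
  have hdvd : ∀ x y, Relation.ReflTransGen (DivStep b₁ b₂) x y → x ∣ y := by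
    intro x y h
    induction h with
    | refl => exact dvd_refl x
    | tail _ h2 ih =>
      obtain ⟨_, i, rfl⟩ := h2
      exact ih.trans (dvd_mul_right _ _)
  obtain ⟨m, hm1, hm2⟩ := newman (DivStep b₁ b₂) L (L b₁)
    (by rintro x y ⟨_, i, rfl⟩; rw [hL, hL1]; omega)
    (by rintro x y ⟨⟨⟨c, hc⟩, _⟩, _⟩; rw [hc, hL]; omega)
    (by
      rintro v _ _ ⟨ha, i, rfl⟩ ⟨hb, j, rfl⟩
      by_cases hij : i = j
      · subst hij
        exact ⟨_, Relation.ReflTransGen.refl, Relation.ReflTransGen.refl⟩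
      have key : ∀ b : M.BraidMonoid, v * mkw M [i] ∣ b → v * mkw M [j] ∣ b →
          M i j ≠ 0 ∧ v * mkw M (alt i j (M i j)) ∣ b := by
        rintro b ⟨c, rfl⟩ ⟨d, hd⟩
        rw [mul_assoc, mul_assoc] at hd
        have h1 := cancel hd
        obtain ⟨hM, h2⟩ := lcm_gen hij (Dvd.intro _ rfl) (Dvd.intro _ h1.symm)
        refine ⟨hM, ?_⟩
        rw [mul_assoc]
        exact mul_dvd_mul_left v h2
      obtain ⟨hM, k1⟩ := key b₁ ha.1 hb.1
      obtain ⟨_, k2⟩ := key b₂ ha.2 hb.2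
      obtain ⟨m, hm⟩ : ∃ m, M i j = m + 1 := ⟨M i j - 1, by omega⟩
      have e1 : v * mkw M (alt i j (M i j)) = v * mkw M [i] * mkw M (alt j i m) := by
        rw [hm, alt, mkw_cons, mul_assoc]
      have e2 : v * mkw M (alt i j (M i j)) = v * mkw M [j] * mkw M (alt i j m) := by
        rw [mkw_alt_comm, hm, alt, mkw_cons, mul_assoc]
      refine ⟨v * mkw M (alt i j (M i j)), ?_, ?_⟩
      · rw [e1] at k1 k2 ⊢
        exact div_path b₁ b₂ _ _ ⟨k1, k2⟩
      · rw [e2] at k1 k2 ⊢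
        exact div_path b₁ b₂ _ _ ⟨k1, k2⟩) 1
  refine ⟨m, ?_, ?_⟩
  · rcases Relation.ReflTransGen.cases_tail hm1 with h | ⟨_, _, h⟩
    · rw [h]; exact ⟨one_dvd _, one_dvd _⟩
    · exact h.1
  · intro a ha1 ha2
    obtain ⟨ω, rfl⟩ := exists_mkw a
    have := div_path b₁ b₂ ω 1 (by rw [one_mul]; exact ⟨ha1, ha2⟩)
    rw [one_mul] at this
    exact hdvd _ _ (hm2 _ this)

end BraidGCD

/-- Existence of greatest common prefixes (left gcds) in the positive braid
monoid. -/
theorem braidMonoid_exists_greatest_common_prefix {B : Type*} (M : CoxeterMatrix B)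
    (b₁ b₂ : M.BraidMonoid) :
    ∃ g : M.BraidMonoid, (g ∣ b₁ ∧ g ∣ b₂) ∧
      ∀ a : M.BraidMonoid, a ∣ b₁ → a ∣ b₂ → a ∣ g := by
  exact BraidGCD.gcd_exists b₁ b₂
end

section
/- Let (W, S) be a Coxeter system, s ∈ S, and w ∈ W with s ≤_Pre w and |L(w)| ≥ 2, where L(w) is the set of simple left-prefixes of w. Let Word_s^{1f}(w) be the poset of reduced factorizations (v₁, …, vₙ) of w (i.e., ℓ(v₁) + ⋯ + ℓ(vₙ) = ℓ(w), each vᵢ ≠ 1) such that v₁ generates a finite parabolic, s ∈ L(v₁), and |L(v₁)| ≥ 2, ordered by refinement. Then the nerve of Word_s^{1f}(w) is contractible. -/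
/-!
STATEMENT 14.  Let `(W, S)` be a Coxeter system, `s ∈ S`, and `w ∈ W` with
`s ≤_Pre w` (i.e. `s` is a left descent of `w`) and `|L(w)| ≥ 2`, where `L(w)`
is the set of simple left-prefixes (left descents) of `w`.  Let
`Word_s^{1f}(w)` be the poset of reduced factorizations `(v₁, …, vₙ)` of `w`
(i.e. `v₁ ⋯ vₙ = w`, `ℓ(v₁) + ⋯ + ℓ(vₙ) = ℓ(w)`, each `vᵢ ≠ 1`) such that `v₁`
lies in a finite standard parabolic, `s ∈ L(v₁)`, and `|L(v₁)| ≥ 2`, ordered by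
refinement (block multiplication).  Then the nerve of `Word_s^{1f}(w)` is
contractible.
-/

open CoxeterSystem CategoryTheory

variable {B : Type} {W : Type} [Group W] {M : CoxeterMatrix B}

/-- One step of the refinement (coarsening) order on factorizations:
`l` refines `l'` if `l'` is obtained from `l` by multiplying together
consecutive blocks. -/
def ListRefines (l l' : List W) : Prop :=
  ∃ L : List (List W), L.flatten = l ∧ L.map List.prod = l'

/-- The poset `Word_s^{1f}(w)` of reduced factorizations of `w` whose first
letter lies in a finite standard parabolic, has `s` as a left descent, and has
at least two left descents. -/
structure WordS1f (cs : CoxeterSystem M W) (s : B) (w : W) where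
  letters : List W
  nonempty : letters ≠ []
  prod_eq : letters.prod = w
  reduced : (letters.map cs.length).sum = cs.length w
  ne_one : ∀ v ∈ letters, v ≠ 1
  first_finite : ∃ T : Set B, (Subgroup.closure (cs.simple '' T) : Set W).Finite ∧
    letters.head nonempty ∈ Subgroup.closure (cs.simple '' T)
  first_descent : cs.IsLeftDescent (letters.head nonempty) s
  first_two_descents : ∃ s' : B, s' ≠ s ∧ cs.IsLeftDescent (letters.head nonempty) s'

instance (cs : CoxeterSystem M W) (s : B) (w : W) : Preorder (WordS1f cs s w) where
  le := Relation.ReflTransGen fun x y => ListRefines x.letters y.letters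
  le_refl _ := Relation.ReflTransGen.refl
  le_trans _ _ _ h h2 := Relation.ReflTransGen.trans h h2

namespace WNC

section Top

open Simplicial Opposite

noncomputable def pt {P : Type} [Preorder P] (n : SimplexCategory) (q : Fin (n.len+1) →o P) :
    C(stdSimplex ℝ (Fin (n.len+1)), SSet.toTop.obj (nerve P)) :=
  TopCat.toSSetObjEquiv (SSet.toTop.obj (nerve P)) (op n) ((sSetTopAdj.unit.app (nerve P)).app (op n) q.monotone.functor)

lemma pt_map {P : Type} [Preorder P] {n m : SimplexCategory} (α : n ⟶ m) (q : Fin (m.len+1) →o P)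
    (t : stdSimplex ℝ (Fin (n.len+1))) :
    pt n (q.comp α.toOrderHom) t = pt m q (stdSimplex.map α t) := by
  have h := (sSetTopAdj.unit.app (nerve P)).naturality α.op
  have h2 := ConcreteCategory.congr_hom h q.monotone.functor
  unfold pt
  rw [← TopCat.toSSetObjEquiv_naturality_apply]
  exact congrArg (fun z => TopCat.toSSetObjEquiv (SSet.toTop.obj (nerve P)) (op n) z t) h2

/-- realization of a monotone map -/
noncomputable def rmap {P Q : Type} [Preorder P] [Preorder Q] (f : P →o Q) :
    C(SSet.toTop.obj (nerve P), SSet.toTop.obj (nerve Q)) :=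
  (SSet.toTop.map (nerveMap f.monotone.functor)).hom

lemma pt_nat {P Q : Type} [Preorder P] [Preorder Q] (f : P →o Q) {n : SimplexCategory} (q : Fin (n.len+1) →o P)
    (t : stdSimplex ℝ (Fin (n.len+1))) :
    rmap f (pt n q t) = pt n (f.comp q) t := by
  have h := sSetTopAdj.unit.naturality (nerveMap f.monotone.functor)
  have h2 := ConcreteCategory.congr_hom (NatTrans.congr_app h (op n)) q.monotone.functor
  exact congrArg (fun z => TopCat.toSSetObjEquiv (SSet.toTop.obj (nerve Q)) (op n) z t) h2.symm

/-- maps out of a realization are determined on the points `pt`. -/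
lemma hom_ext' {P : Type} [Preorder P] {Z : TopCat.{0}} (f g : SSet.toTop.obj (nerve P) ⟶ Z)
    (h : ∀ n (q : Fin (n.len+1) →o P) t, f.hom (pt n q t) = g.hom (pt n q t)) : f = g := by
  apply (sSetTopAdj.homEquiv _ _).injective
  rw [Adjunction.homEquiv_unit, Adjunction.homEquiv_unit]
  ext n x
  induction n using Opposite.rec with | _ n => 
  apply (TopCat.toSSetObjEquiv Z (op n)).injective
  ext t
  let q : Fin (n.len+1) →o P := ⟨x.obj, x.monotone⟩
  exact h n q t


lemma stdmap_apply {X Y : Type} [Fintype X] [Fintype Y] [DecidableEq Y] (f : X → Y) (t : stdSimplex ℝ X) (y : Y) :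
    stdSimplex.map f t y = ∑ x with f x = y, t x := by
  rw [stdSimplex.map_coe, FunOnFinite.linearMap_apply_apply]

lemma stdmap_congr {X Y : Type} [Fintype X] [Fintype Y] (f g : X → Y) (t : stdSimplex ℝ X)
    (h : ∀ x, t x ≠ 0 → f x = g x) : stdSimplex.map f t = stdSimplex.map g t := by
  classical
  apply DFunLike.ext
  intro y
  rw [stdmap_apply, stdmap_apply, Finset.sum_filter, Finset.sum_filter]
  refine Finset.sum_congr rfl fun x _ => ?_
  by_cases hx : t x = 0
  · simp [hx]
  · rw [h x hx]

lemma stdmap_inj_apply {X Y : Type} [Fintype X] [Fintype Y] (f : X → Y) (hf : Function.Injective f)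
    (t : stdSimplex ℝ X) (x : X) : stdSimplex.map f t (f x) = t x := by
  classical
  rw [stdmap_apply]
  have : (Finset.univ.filter fun a => f a = f x) = {x} := by
    ext a; simp [hf.eq_iff]
  rw [this, Finset.sum_singleton]

lemma stdmap_inj {X Y : Type} [Fintype X] [Fintype Y] (f : X → Y) (hf : Function.Injective f) (t t' : stdSimplex ℝ X)
    (h : stdSimplex.map f t = stdSimplex.map f t') : t = t' := by
  classical
  apply DFunLike.ext
  intro x
  have := congrArg (fun z => z (f x)) h
  simpa only [stdmap_inj_apply f hf] using this

lemma std_nonneg {X : Type} [Fintype X] (t : stdSimplex ℝ X) (x : X) : 0 ≤ t x := t.2.1 x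

lemma stdmap_ne_zero {X Y : Type} [Fintype X] [Fintype Y] (f : X → Y) (t : stdSimplex ℝ X)
    (x : X) (h : t x ≠ 0) : stdSimplex.map f t (f x) ≠ 0 := by
  classical
  rw [stdmap_apply]
  intro h0
  rw [Finset.sum_eq_zero_iff_of_nonneg (fun i _ => std_nonneg t i)] at h0
  exact h (h0 x (by simp))

lemma stdmap_range {X Y : Type} [Fintype X] [Fintype Y] (f : X → Y) (t : stdSimplex ℝ X)
    (y : Y) (h : stdSimplex.map f t y ≠ 0) : ∃ x, f x = y := by
  classical
  rw [stdmap_apply] at h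
  obtain ⟨x, hx, _⟩ := Finset.exists_ne_zero_of_sum_ne_zero h
  exact ⟨x, by simpa using hx⟩

/-- pull back weights along an injection whose range contains the support -/
lemma exists_pull {X Y : Type} [Fintype X] [Fintype Y] (f : X → Y) (hf : Function.Injective f) (m : stdSimplex ℝ Y)
    (h : ∀ y, m y ≠ 0 → ∃ x, f x = y) : ∃ t : stdSimplex ℝ X, (∀ x, t x = m (f x)) ∧ stdSimplex.map f t = m := by
  classical
  have key : ∑ x, m (f x) = 1 := by
    rw [← m.2.2, ← Finset.sum_image (f := fun y => m y) (g := f) (s := Finset.univ) (fun a _ b _ hab => hf hab)]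
    refine Finset.sum_subset (Finset.subset_univ _) fun y _ hy => ?_
    by_contra h0
    obtain ⟨x, rfl⟩ := h y h0
    exact hy (by simp)
  refine ⟨⟨fun x => m (f x), fun x => std_nonneg m _, key⟩, fun x => rfl, ?_⟩
  apply DFunLike.ext
  intro y
  by_cases h0 : m y = 0
  · rw [h0, stdmap_apply]
    refine Finset.sum_eq_zero fun x hx => ?_
    simp only [Finset.mem_filter] at hx
    change m (f x) = 0
    rw [hx.2, h0]
  · obtain ⟨x, rfl⟩ := h y h0
    rw [stdmap_inj_apply f hf]
    rfl

lemma pt_congr {P : Type} [Preorder P] {n : SimplexCategory} (q q' : Fin (n.len+1) →o P)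
    (t : stdSimplex ℝ (Fin (n.len+1))) (h : ∀ i, t i ≠ 0 → q i = q' i) : pt n q t = pt n q' t := by
  classical
  let A : Finset (Fin (n.len+1)) := Finset.univ.filter fun i => t i ≠ 0
  have hA : A.Nonempty := by
    by_contra h0
    rw [Finset.not_nonempty_iff_eq_empty] at h0
    have h1 : ∀ i, t i = 0 := by
      intro i
      by_contra hi
      have : i ∈ A := by simp [A, hi]
      simp [h0] at this
    have h2 : ∑ i, t i = 1 := t.2.2
    simp [h1] at h2
  obtain ⟨r, hr⟩ : ∃ r, A.card = r + 1 := ⟨A.card - 1, by have := hA.card_pos; omega⟩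
  let e := A.orderEmbOfFin hr
  let α : SimplexCategory.mk r ⟶ n := SimplexCategory.Hom.mk e.toOrderHom
  obtain ⟨t', -, ht'⟩ := exists_pull (X := Fin (r+1)) e e.injective t (by
    intro y hy
    have : y ∈ Set.range e := by
      rw [Finset.range_orderEmbOfFin]; simp [A, hy]
    exact this)
  have h1 : stdSimplex.map α t' = t := ht'
  have h2 := pt_map α q t'
  have h3 := pt_map α q' t'
  rw [h1] at h2 h3
  rw [← h2, ← h3]
  congr 2
  ext i
  apply h
  have : e i ∈ A := Finset.orderEmbOfFin_mem _ _ _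
  exact (Finset.mem_filter.mp this).2

lemma pt_eq {K : Type} [PartialOrder K] [Fintype K] {m r : SimplexCategory} (q : Fin (m.len+1) →o K)
    (e : Fin (r.len+1) →o K) (he : Function.Injective e)
    (t : stdSimplex ℝ (Fin (m.len+1))) (t' : stdSimplex ℝ (Fin (r.len+1)))
    (h : stdSimplex.map q t = stdSimplex.map e t') : pt m q t = pt r e t' := by
  classical
  have hsm : StrictMono e := e.monotone.strictMono_of_injective he
  let γ : Fin (m.len+1) →o Fin (r.len+1) :=
    ⟨fun i => (Finset.univ.filter fun a : Fin (r.len+1) => e a ≤ q i).sup id, by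
      intro i j hij
      apply Finset.sup_mono
      intro a ha
      simp only [Finset.mem_filter, Finset.mem_univ, true_and] at ha ⊢
      exact ha.trans (q.monotone hij)⟩
  have hγ : ∀ i, t i ≠ 0 → q i = e (γ i) := by
    intro i hi
    have h1 := stdmap_ne_zero q t i hi
    rw [h] at h1
    obtain ⟨b, hb⟩ := stdmap_range _ _ _ h1
    rw [← hb]
    congr 1
    apply le_antisymm
    · exact Finset.le_sup (f := (id : Fin (r.len+1) → Fin (r.len+1))) (b := b) (by simp [hb])
    · refine Finset.sup_le (α := Fin (r.len+1)) fun a ha => ?_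
      simp only [Finset.mem_filter, Finset.mem_univ, true_and, ← hb] at ha
      exact hsm.le_iff_le.mp ha
  rw [pt_congr q (e.comp γ) t hγ]
  have := pt_map (n := m) (m := r) (SimplexCategory.Hom.mk γ) e t
  refine this.trans ?_
  congr 1
  apply stdmap_inj e he
  rw [← h, stdmap_congr q (e.comp γ) t hγ]
  exact stdSimplex.map_comp_apply _ _ _

lemma exists_H {K : Type} [PartialOrder K] [Fintype K] {X : Type} [TopologicalSpace X] (r : SimplexCategory)
    (M : X → stdSimplex ℝ K) (hM : Continuous M)
    (hc : ∀ x, ∃ e : Fin (r.len+1) →o K, Function.Injective e ∧ ∀ k, M x k ≠ 0 → ∃ a, e a = k) :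
    ∃ H : C(X, SSet.toTop.obj (nerve K)), ∀ x (m : SimplexCategory) (q : Fin (m.len+1) →o K)
      (t : stdSimplex ℝ (Fin (m.len+1))), stdSimplex.map q t = M x → pt m q t = H x := by
  classical
  choose e he1 he2 using hc
  choose p hp1 hp2 using fun x => exists_pull (e x) (he1 x) (M x) (he2 x)
  let H0 : X → SSet.toTop.obj (nerve K) := fun x => pt r (e x) (p x)
  have key : ∀ x (m : SimplexCategory) (q : Fin (m.len+1) →o K)
      (t : stdSimplex ℝ (Fin (m.len+1))), stdSimplex.map q t = M x → pt m q t = H0 x := by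
    intro x m q t h
    exact pt_eq q (e x) (he1 x) t (p x) (h.trans (hp2 x).symm)
  refine ⟨⟨H0, ?_⟩, key⟩
  let A : (Fin (r.len+1) →o K) → Set X := fun f => {x | Function.Injective f ∧ ∀ k, (¬ ∃ a, f a = k) → M x k = 0}
  have : Finite (Fin (r.len+1) →o K) := Finite.of_injective (fun f => (f : Fin (r.len+1) → K)) DFunLike.coe_injective
  have hMk : ∀ k, Continuous fun x => M x k := fun k =>
    (continuous_apply k).comp (continuous_subtype_val.comp hM)
  refine LocallyFinite.continuous (f := A) (locallyFinite_of_finite A) ?_ ?_ ?_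
  · rw [Set.eq_univ_iff_forall]
    intro x
    rw [Set.mem_iUnion]
    refine ⟨e x, he1 x, fun k hk => ?_⟩
    by_contra h0
    exact hk (he2 x k h0)
  · intro f
    by_cases hf : Function.Injective f
    · have : A f = ⋂ k, ⋂ (_ : ¬ ∃ a, f a = k), {x | M x k = 0} := by
        ext x; simp [A, hf]
      rw [this]
      exact isClosed_iInter fun k => isClosed_iInter fun _ => isClosed_eq (hMk k) continuous_const
    · have : A f = ∅ := by ext x; simp [A, hf]
      rw [this]; exact isClosed_empty
  · intro f
    by_cases hf : Function.Injective f
    swap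
    · have : A f = ∅ := by ext x; simp [A, hf]
      rw [this]; exact continuousOn_empty _
    rw [continuousOn_iff_continuous_domRestrict]
    choose p' hp'1 hp'2 using fun x : A f => exists_pull f hf (M x) (by
      intro k hk
      by_contra h0
      exact hk (x.2.2 k h0))
    have e1 : (A f).domRestrict H0 = fun x => pt r f (p' x) := by
      funext x
      exact (key x r f (p' x) (hp'2 x)).symm
    rw [e1]
    refine (pt r f).continuous.comp ?_
    refine Continuous.subtype_mk (f := fun x => (p' x : Fin (r.len+1) → ℝ)) ?_ (fun x => (p' x).2)
    refine continuous_pi fun a => ?_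
    have : (fun x => (p' x : Fin (r.len+1) → ℝ) a) = fun x : A f => M x (f a) := by
      funext x; exact hp'1 x a
    rw [this]
    exact (hMk _).comp continuous_subtype_val


lemma telescope {n : ℕ} (t : Fin n → ℝ) (G : ℝ → ℝ) (D : Finset (Fin n)) (hD : ∀ i j, i ≤ j → j ∈ D → i ∈ D) :
    ∑ j ∈ D, (G (∑ i with i ≤ j, t i) - G (∑ i with i < j, t i)) = G (∑ i ∈ D, t i) - G 0 := by
  classical
  induction D using Finset.induction_on_max with
  | empty => simp
  | insert m D hm ih =>
    have hmD : m ∉ D := fun h => lt_irrefl _ (hm m h)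
    have h1 : (Finset.univ.filter fun i => i ≤ m) = insert m D := by
      ext i
      simp only [Finset.mem_filter, Finset.mem_univ, true_and]
      constructor
      · intro h; exact hD i m h (by simp)
      · intro h
        rcases Finset.mem_insert.mp h with rfl | h
        · exact le_rfl
        · exact (hm i h).le
    have h2 : (Finset.univ.filter fun i => i < m) = D := by
      ext i
      simp only [Finset.mem_filter, Finset.mem_univ, true_and]
      constructor
      · intro h
        rcases Finset.mem_insert.mp (hD i m h.le (by simp)) with rfl | h'
        · exact absurd h (lt_irrefl _)
        · exact h'
      · intro h; exact hm i h
    rw [Finset.sum_insert hmD, h1, h2, ih]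
    · ring
    · intro i j hij hj
      rcases Finset.mem_insert.mp (hD i j hij (by simp [hj])) with rfl | h'
      · exact absurd (hm j hj) (not_lt.mpr hij)
      · exact h'

/-- truncation -/
noncomputable def Gf (c : ℝ) (b : Bool) (x : ℝ) : ℝ := if b then max x c else min x c

lemma Gf_mono (c : ℝ) (b : Bool) : Monotone (Gf c b) := by
  intro x y h
  cases b
  · simpa [Gf] using min_le_min_right c h
  · simpa [Gf] using max_le_max_right c h

lemma Gf_cont (b : Bool) : Continuous fun p : ℝ × ℝ => Gf p.1 b p.2 := by
  cases b
  · simp only [Gf, Bool.false_eq_true, if_false]; fun_prop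
  · simp only [Gf, if_true]; fun_prop

/-- weights on the prism -/
noncomputable def Mw {n : ℕ} (t : Fin n → ℝ) (c : ℝ) (k : Fin n × Bool) : ℝ :=
  Gf c k.2 (∑ i with i ≤ k.1, t i) - Gf c k.2 (∑ i with i < k.1, t i)

noncomputable def Mst {n : ℕ} (x : stdSimplex ℝ (Fin n) × unitInterval) : stdSimplex ℝ (Fin n × Bool) :=
  ⟨Mw x.1 (1 - x.2), by
    intro k
    unfold Mw
    rw [sub_nonneg]
    apply Gf_mono
    apply Finset.sum_le_sum_of_subset_of_nonneg
    · intro i hi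
      simp only [Finset.mem_filter, Finset.mem_univ, true_and] at hi ⊢
      exact hi.le
    · intro i _ _; exact std_nonneg _ _, by
    rw [Fintype.sum_prod_type]
    have h := fun b => telescope x.1 (Gf (1 - x.2) b) Finset.univ (by simp)
    rw [Finset.sum_comm]
    have h1 : ∑ i, x.1 i = 1 := x.1.2.2
    simp only [Fintype.sum_bool, Mw, h, h1]
    have := x.2.2.1
    have := x.2.2.2
    simp only [Gf, if_true, Bool.false_eq_true, if_false]
    rw [max_eq_left (by linarith), max_eq_right (by linarith), min_eq_right (by linarith), min_eq_left (by linarith)]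
    ring⟩

lemma Mst_cont {n : ℕ} : Continuous (Mst (n := n)) := by
  refine Continuous.subtype_mk (continuous_pi fun k => ?_) _
  have ht : ∀ i, Continuous fun x : stdSimplex ℝ (Fin n) × unitInterval => x.1 i := fun i =>
    (continuous_apply i).comp (continuous_subtype_val.comp continuous_fst)
  have hc : Continuous fun x : stdSimplex ℝ (Fin n) × unitInterval => (1 - x.2 : ℝ) := by fun_prop
  unfold Mw
  refine Continuous.sub ?_ ?_
  · exact (Gf_cont k.2).comp (hc.prodMk (continuous_finsetSum (Finset.univ.filter fun i => i ≤ k.1) fun i _ => ht i))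
  · exact (Gf_cont k.2).comp (hc.prodMk (continuous_finsetSum (Finset.univ.filter fun i => i < k.1) fun i _ => ht i))

lemma Mst_nat {n m : ℕ} (α : Fin n →o Fin m) (t : stdSimplex ℝ (Fin n)) (u : unitInterval) :
    stdSimplex.map (Prod.map α id) (Mst (t, u)) = Mst (stdSimplex.map α t, u) := by
  classical
  apply DFunLike.ext
  rintro ⟨k, b⟩
  rw [stdmap_apply]
  change ∑ x with _, Mw t (1 - u) x = Mw (stdSimplex.map α t) (1-u) (k, b)
  unfold Mw
  simp only
  have e1 : ∀ p : Fin m → Prop, [DecidablePred p] → ∑ i with p i, stdSimplex.map α t i = ∑ j with p (α j), t j := by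
    intro p _
    simp only [stdmap_apply]
    rw [Finset.sum_comm' (t' := Finset.univ.filter fun j => p (α j)) (s' := fun j => {α j})]
    · simp
    · intro x y; simp; constructor
      · rintro ⟨h, rfl⟩; exact ⟨rfl, h⟩
      · rintro ⟨rfl, h⟩; exact ⟨h, rfl⟩
  rw [e1, e1]
  have h1 := telescope t (Gf (1-u) b) (Finset.univ.filter fun j => α j ≤ k) (by
    intro i j hij hj; simp at hj ⊢; exact (α.monotone hij).trans hj)
  have h2 := telescope t (Gf (1-u) b) (Finset.univ.filter fun j => α j < k) (by
    intro i j hij hj; simp at hj ⊢; exact (α.monotone hij).trans_lt hj)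
  have h3 : (Finset.univ.filter fun j => α j ≤ k) = (Finset.univ.filter fun j => α j = k) ∪ (Finset.univ.filter fun j => α j < k) := by
    ext j; simp [le_iff_eq_or_lt]
  have h4 : (Finset.univ.filter fun x : Fin n × Bool => Prod.map α id x = (k, b)) =
      (Finset.univ.filter fun j => α j = k) ×ˢ {b} := by
    ext ⟨j, b'⟩; simp; intro _; exact eq_comm
  rw [h4, Finset.sum_product]
  simp only [Finset.sum_singleton]
  rw [h3, Finset.sum_union (by
    rw [Finset.disjoint_left]; intro a ha hb; simp at ha hb; exact hb.ne ha), h2] at h1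
  rw [← h3] at h1
  linarith

/-- the maximal chain of the prism jumping at `j` -/
def chainFun {n : ℕ} (j : Fin (n+1)) (i : Fin (n+1+1)) : Fin (n+1) × Bool :=
  if h : i.val ≤ j.val then (⟨i.val, by omega⟩, false) else (⟨i.val - 1, by omega⟩, true)

def chainMap {n : ℕ} (j : Fin (n+1)) : Fin (n+1+1) →o Fin (n+1) × Bool :=
  ⟨chainFun j, by
    intro a b hab
    have hab' : a.val ≤ b.val := hab
    unfold chainFun
    split_ifs with h1 h2 h2
    · exact ⟨hab', le_rfl⟩
    · refine ⟨?_, Bool.false_le _⟩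
      change a.val ≤ b.val - 1; omega
    · omega
    · refine ⟨?_, le_rfl⟩
      change a.val - 1 ≤ b.val - 1; omega⟩

lemma chainMap_inj {n : ℕ} (j : Fin (n+1)) : Function.Injective (chainMap j) := by
  intro a b hab
  change chainFun j a = chainFun j b at hab
  unfold chainFun at hab
  split_ifs at hab with h1 h2 h2
  · simp at hab; apply Fin.ext; omega
  · simp at hab
  · simp at hab
  · simp at hab; apply Fin.ext; omega

lemma Mst_cover {n : ℕ} (x : stdSimplex ℝ (Fin (n+1)) × unitInterval) :
    ∃ e : Fin (n+1+1) →o Fin (n+1) × Bool, Function.Injective e ∧ ∀ k, Mst x k ≠ 0 → ∃ a, e a = k := by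
  classical
  obtain ⟨t, u⟩ := x
  have hlast : (1 - u : ℝ) ≤ ∑ i with i ≤ Fin.last n, t i := by
    have h1 : ∑ i, t i = 1 := t.2.2
    have := u.2.1
    simp [Fin.le_last, h1, this]
  let A := Finset.univ.filter fun j : Fin (n+1) => (1 - u : ℝ) ≤ ∑ i with i ≤ j, t i
  have hA : A.Nonempty := ⟨Fin.last n, by simp only [A, Finset.mem_filter, Finset.mem_univ, true_and]; exact hlast⟩
  let j := A.min' hA
  have hj1 : (1 - u : ℝ) ≤ ∑ i with i ≤ j, t i := (Finset.mem_filter.mp (A.min'_mem hA)).2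
  have hj2 : ∀ i, (1 - u : ℝ) ≤ ∑ i' with i' ≤ i, t i' → j ≤ i := fun i hi =>
    A.min'_le i (by simp only [A, Finset.mem_filter, Finset.mem_univ, true_and]; exact hi)
  refine ⟨chainMap j, chainMap_inj j, ?_⟩
  · rintro ⟨k, b⟩ hk
    change Mw t (1 - u) (k, b) ≠ 0 at hk
    cases b
    · have : k ≤ j := by
        by_contra h
        push Not at h
        apply hk
        have h1 : ∑ i with i ≤ j, t i ≤ ∑ i with i < k, t i := by
          apply Finset.sum_le_sum_of_subset_of_nonneg
          · intro i hi
            simp only [Finset.mem_filter, Finset.mem_univ, true_and] at hi ⊢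
            exact hi.trans_lt h
          · intro i _ _; exact std_nonneg _ _
        have h2 : ∑ i with i < k, t i ≤ ∑ i with i ≤ k, t i := by
          apply Finset.sum_le_sum_of_subset_of_nonneg
          · intro i hi
            simp only [Finset.mem_filter, Finset.mem_univ, true_and] at hi ⊢
            exact hi.le
          · intro i _ _; exact std_nonneg _ _
        simp only [Mw, Gf]
        simp [min_eq_right (hj1.trans h1), min_eq_right ((hj1.trans h1).trans h2)]
      refine ⟨⟨k.val, by omega⟩, ?_⟩
      have : k.val ≤ j.val := this
      change chainFun j _ = _
      unfold chainFun
      rw [dif_pos this]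
    · have : j ≤ k := by
        by_contra h
        have h0 : ∑ i with i ≤ k, t i ≤ (1 - u : ℝ) := by
          by_contra h'
          exact h (hj2 k (not_le.mp h').le)
        apply hk
        have h2 : ∑ i with i < k, t i ≤ ∑ i with i ≤ k, t i := by
          apply Finset.sum_le_sum_of_subset_of_nonneg
          · intro i hi
            simp only [Finset.mem_filter, Finset.mem_univ, true_and] at hi ⊢
            exact hi.le
          · intro i _ _; exact std_nonneg _ _
        simp only [Mw, Gf]
        simp [max_eq_right h0, max_eq_right (h2.trans h0)]
      have : j.val ≤ k.val := this
      refine ⟨⟨k.val + 1, by omega⟩, ?_⟩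
      have h' : ¬ (k.val + 1 ≤ j.val) := by omega
      change chainFun j _ = _
      unfold chainFun
      rw [dif_neg h']
      rfl

/-- the inclusion at an end of the prism -/
def inc (n : ℕ) (b : Bool) : Fin n →o Fin n × Bool := ⟨fun i => (i, b), fun _ _ h => ⟨h, le_rfl⟩⟩

lemma Mst_end {n : ℕ} (t : stdSimplex ℝ (Fin n)) (b : Bool) :
    stdSimplex.map (inc n b) t = Mst (t, if b then 1 else 0) := by
  classical
  apply DFunLike.ext
  rintro ⟨k, b'⟩
  have hs : ∀ D : Finset (Fin n), 0 ≤ ∑ i ∈ D, t i ∧ ∑ i ∈ D, t i ≤ 1 := by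
    intro D
    refine ⟨Finset.sum_nonneg fun i _ => std_nonneg _ _, ?_⟩
    rw [← t.2.2]
    exact Finset.sum_le_sum_of_subset_of_nonneg (Finset.subset_univ _) fun i _ _ => std_nonneg _ _
  have h3 : (Finset.univ.filter fun j => j ≤ k) = insert k (Finset.univ.filter fun j => j < k) := by
    ext j; simp [le_iff_eq_or_lt]
  have h4 : ∑ i with i ≤ k, t i = t k + ∑ i with i < k, t i := by
    rw [h3, Finset.sum_insert (by simp)]
  have l : stdSimplex.map (inc n b) t (k, b') = if b = b' then t k else 0 := by
    by_cases h : b = b'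
    · subst h
      rw [if_pos rfl]
      exact stdmap_inj_apply (inc n b) (fun x y h => congrArg Prod.fst h) t k
    · rw [if_neg h]
      by_contra h0
      obtain ⟨x, hx⟩ := stdmap_range _ _ _ h0
      exact h (congrArg Prod.snd hx)
  rw [l]
  change _ = Mw t (1 - _) (k, b')
  have a1 := hs (Finset.univ.filter fun i => i ≤ k)
  have a2 := hs (Finset.univ.filter fun i => i < k)
  cases b <;> cases b' <;> simp only [Mw, Gf] <;> simp [min_eq_left, max_eq_left, max_eq_right, min_eq_right, a1, a2] <;> linarith

lemma exists_prism {P Q : Type} [Preorder P] [Preorder Q] (f g : P →o Q) (h : f ≤ g) :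
    ∃ hh : ∀ {n : SimplexCategory}, (Fin (n.len+1) →o P) →
      C(stdSimplex ℝ (Fin (n.len+1)) × unitInterval, SSet.toTop.obj (nerve Q)),
    (∀ {n m : SimplexCategory} (α : n ⟶ m) (q : Fin (m.len+1) →o P) t u,
      hh (q.comp α.toOrderHom) (t, u) = hh q (stdSimplex.map α t, u)) ∧
    ∀ {n : SimplexCategory} (q : Fin (n.len+1) →o P) t (b : Bool),
      hh q (t, if b then 1 else 0) = pt n ((if b then g else f).comp q) t := by
  classical
  let Z := SSet.toTop.obj (nerve Q)
  choose H hH using fun n : SimplexCategory => exists_H (K := Fin (n.len+1) × Bool) (SimplexCategory.mk (n.len+1))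
    (Mst (n := n.len+1)) Mst_cont Mst_cover
  let F : ∀ {n : SimplexCategory}, (Fin (n.len+1) →o P) → (Fin (n.len+1) × Bool →o Q) := fun {n} q =>
    ⟨fun k => if k.2 then g (q k.1) else f (q k.1), by
      rintro ⟨i, b⟩ ⟨j, b'⟩ ⟨h1, h2⟩
      have h1 : i ≤ j := h1
      have h2 : b ≤ b' := h2
      cases b <;> cases b'
      · exact f.monotone (q.monotone h1)
      · exact (f.monotone (q.monotone h1)).trans (h _)
      · exact absurd h2 (by decide)
      · exact g.monotone (q.monotone h1)⟩
  let hh : ∀ {n : SimplexCategory}, (Fin (n.len+1) →o P) → C(stdSimplex ℝ (Fin (n.len+1)) × unitInterval, Z) := fun {n} q =>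
    (rmap (F q)).comp (H n)
  have hhp : ∀ {n : SimplexCategory} (q : Fin (n.len+1) →o P) x (m : SimplexCategory) (r : Fin (m.len+1) →o Fin (n.len+1) × Bool) t,
      stdSimplex.map r t = Mst x → pt m ((F q).comp r) t = hh q x := by
    intro n q x m r t hr
    rw [← pt_nat]
    exact congrArg _ (hH n x m r t hr)
  have hnat : ∀ {n m : SimplexCategory} (α : n ⟶ m) (q : Fin (m.len+1) →o P) t u,
      hh (q.comp α.toOrderHom) (t, u) = hh q (stdSimplex.map α t, u) := by
    intro n m α q t u
    obtain ⟨e, he1, he2⟩ := Mst_cover (n := n.len) (t, u)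
    obtain ⟨p, -, hp⟩ := exists_pull e he1 _ he2
    rw [← hhp (n := n) _ (t, u) (SimplexCategory.mk (n.len+1)) e p hp]
    let r : Fin (n.len + 1 + 1) →o Fin (m.len+1) × Bool :=
      (OrderHom.prodMap α.toOrderHom OrderHom.id).comp e
    rw [← hhp (n := m) q (stdSimplex.map α t, u) (SimplexCategory.mk (n.len+1)) r p]
    · rfl
    · refine Eq.trans ?_ (Mst_nat α.toOrderHom t u)
      rw [← hp]
      exact (stdSimplex.map_comp_apply (e : Fin (n.len + 1 + 1) → _) (Prod.map α.toOrderHom id) p).symm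
  refine ⟨@hh, @hnat, ?_⟩
  intro n q t b
  rw [← hhp q (t, if b then 1 else 0) n (inc _ b) t (Mst_end t b)]
  congr 2
  ext i
  cases b <;> rfl

theorem homotopic_of_le {P Q : Type} [Preorder P] [Preorder Q] (f g : P →o Q) (h : f ≤ g) :
    (rmap f).Homotopic (rmap g) := by
  classical
  let Z := SSet.toTop.obj (nerve Q)
  obtain ⟨hh, hnat, hhe⟩ := exists_prism f g h
  let Y : TopCat.{0} := TopCat.of C(unitInterval, Z)
  let Φ : nerve P ⟶ TopCat.toSSet.obj Y :=
    { app := fun n => TypeCat.ofHom fun x => (TopCat.toSSetObjEquiv Y n).symm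
        (hh (n := n.unop) (⟨x.obj, x.monotone⟩ : Fin (n.unop.len+1) →o P)).curry
      naturality := by
        intro n m α
        ext x
        apply (TopCat.toSSetObjEquiv Y m).injective
        ext t u
        exact hnat α.unop ⟨x.obj, x.monotone⟩ t u }
  let Ψ : SSet.toTop.obj (nerve P) ⟶ Y := (sSetTopAdj.homEquiv _ _).symm Φ
  have hΨ : ∀ n (q : Fin (n.len+1) →o P) t u, (show C(unitInterval, Z) from Ψ.hom (pt n q t)) u = hh q (t, u) := by
    intro n q t u
    have h1 : sSetTopAdj.homEquiv _ _ Ψ = Φ := Equiv.apply_symm_apply _ _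
    rw [Adjunction.homEquiv_unit] at h1
    have h2 := ConcreteCategory.congr_hom (NatTrans.congr_app h1 (op n)) q.monotone.functor
    have h3 := congrArg (fun z => TopCat.toSSetObjEquiv Y (op n) z t) h2
    exact congrArg (fun z : C(unitInterval, Z) => z u) h3
  let ev : ∀ u : unitInterval, Y ⟶ Z := fun u => TopCat.ofHom ⟨fun z : C(unitInterval, Z) => z u, by fun_prop⟩
  have hend : ∀ b : Bool, ∀ x, (show C(unitInterval, Z) from Ψ.hom x) (if b then 1 else 0) =
      rmap (if b then g else f) x := by
    intro b x
    have : Ψ ≫ ev (if b then 1 else 0) = TopCat.ofHom (rmap (if b then g else f)) := by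
      apply hom_ext'
      intro n q t
      refine Eq.trans ?_ (pt_nat _ q t).symm
      refine (hΨ n q t _).trans ?_
      exact hhe q t b
    exact ConcreteCategory.congr_hom this x
  refine ⟨⟨⟨fun p => (show C(unitInterval, Z) from Ψ.hom p.2) p.1, ?_⟩, ?_, ?_⟩⟩
  · have h1 : Continuous fun p : unitInterval × SSet.toTop.obj (nerve P) => ((show C(unitInterval, Z) from Ψ.hom p.2), p.1) :=
      (Ψ.hom.continuous.comp continuous_snd).prodMk continuous_fst
    exact (ContinuousEval.continuous_eval).comp h1
  · intro x; exact hend false x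
  · intro x; exact hend true x


lemma rmap_comp {P Q R : Type} [Preorder P] [Preorder Q] [Preorder R] (g : Q →o R) (f : P →o Q) :
    rmap (g.comp f) = (rmap g).comp (rmap f) := by
  have : TopCat.ofHom (rmap (g.comp f)) = TopCat.ofHom ((rmap g).comp (rmap f)) := by
    apply hom_ext'
    intro n q t
    change rmap (g.comp f) (pt n q t) = rmap g (rmap f (pt n q t))
    rw [pt_nat, pt_nat, pt_nat]
    rfl
  exact congrArg TopCat.Hom.hom this

lemma rmap_id {P : Type} [Preorder P] : rmap (OrderHom.id : P →o P) = ContinuousMap.id _ := by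
  have : TopCat.ofHom (rmap (OrderHom.id : P →o P)) = TopCat.ofHom (ContinuousMap.id _) := by
    apply hom_ext'
    intro n q t
    change rmap _ (pt n q t) = pt n q t
    rw [pt_nat]
    rfl
  exact congrArg TopCat.Hom.hom this

lemma rmap_const {P Q : Type} [Preorder P] [Preorder Q] (x : Q) :
    ∃ z, rmap (OrderHom.const P x) = ContinuousMap.const _ z := by
  let n0 := SimplexCategory.mk 0
  let q0 : Fin (n0.len+1) →o Q := OrderHom.const _ x
  let t0 : stdSimplex ℝ (Fin (n0.len+1)) := ⟨fun _ => 1, fun _ => zero_le_one, by simp [n0]⟩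
  refine ⟨pt n0 q0 t0, ?_⟩
  have : TopCat.ofHom (rmap (OrderHom.const P x)) = TopCat.ofHom (ContinuousMap.const _ (pt n0 q0 t0)) := by
    apply hom_ext'
    intro n q t
    change rmap _ (pt n q t) = pt n0 q0 t0
    rw [pt_nat]
    let α : n ⟶ n0 := SimplexCategory.Hom.mk (OrderHom.const _ 0)
    refine (pt_map α q0 t).trans ?_
    congr 1
    have : Subsingleton (stdSimplex ℝ (Fin (n0.len+1))) := by
      constructor
      intro a b
      apply DFunLike.ext
      intro i
      have ha : ∑ i : Fin 1, a i = 1 := a.2.2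
      have hb : ∑ i : Fin 1, b i = 1 := b.2.2
      have hi : i = (0 : Fin 1) := Subsingleton.elim (α := Fin 1) _ _
      simp at ha hb
      rw [hi]
      exact ha.trans hb.symm
    exact Subsingleton.elim _ _
  exact congrArg TopCat.Hom.hom this

/-- monotone maps with homotopic realizations -/
def Ht {P Q : Type} [Preorder P] [Preorder Q] (f g : P →o Q) : Prop := (rmap f).Homotopic (rmap g)

lemma Ht.of_le {P Q : Type} [Preorder P] [Preorder Q] {f g : P →o Q} (h : f ≤ g) : Ht f g := homotopic_of_le f g h

lemma Ht.refl {P Q : Type} [Preorder P] [Preorder Q] (f : P →o Q) : Ht f f := ContinuousMap.Homotopic.refl _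

lemma Ht.symm {P Q : Type} [Preorder P] [Preorder Q] {f g : P →o Q} (h : Ht f g) : Ht g f :=
  ContinuousMap.Homotopic.symm h

lemma Ht.trans {P Q : Type} [Preorder P] [Preorder Q] {f g k : P →o Q} (h : Ht f g) (h' : Ht g k) : Ht f k :=
  ContinuousMap.Homotopic.trans h h'

lemma Ht.comp {P Q R S : Type} [Preorder P] [Preorder Q] [Preorder R] [Preorder S] {f g : Q →o R} (h : Ht f g)
    (a : P →o Q) (b : R →o S) : Ht (b.comp (f.comp a)) (b.comp (g.comp a)) := by
  unfold Ht at *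
  rw [rmap_comp, rmap_comp, rmap_comp, rmap_comp]
  exact (ContinuousMap.Homotopic.refl _).comp (h.comp (ContinuousMap.Homotopic.refl _))

lemma contractible_of_ht {P : Type} [Preorder P] (x : P) (h : Ht (OrderHom.id : P →o P) (OrderHom.const P x)) :
    ContractibleSpace (SSet.toTop.obj (nerve P)) := by
  rw [contractible_iff_id_nullhomotopic]
  obtain ⟨z, hz⟩ := rmap_const (P := P) x
  refine ⟨z, ?_⟩
  unfold Ht at h
  rwa [rmap_id, hz] at h

end Top

section Cox
open scoped Classical in
/-- action on signed reflections -/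
noncomputable def sf (cs : CoxeterSystem M W) (i : B) : Function.End (W × ZMod 2) :=
  fun x => (cs.simple i * x.1 * cs.simple i, x.2 + if x.1 = cs.simple i then 1 else 0)

open scoped Classical in
lemma sf_word (cs : CoxeterSystem M W) (ω : List B) (x : W × ZMod 2) :
    (ω.map (sf cs)).prod x = (cs.wordProd ω * x.1 * (cs.wordProd ω)⁻¹, x.2 + (((cs.rightInvSeq ω).count x.1 : ℕ) : ZMod 2)) := by
  induction ω with
  | nil =>
    simp [rightInvSeq]
    rfl
  | cons i ω ih =>
    rw [List.map_cons, List.prod_cons]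
    change sf cs i ((ω.map (sf cs)).prod x) = _
    rw [ih]
    unfold sf
    refine Prod.ext ?_ ?_
    · simp [wordProd_cons, mul_assoc]
    · simp only [rightInvSeq, List.count_cons]
      have : (cs.wordProd ω * x.1 * (cs.wordProd ω)⁻¹ = cs.simple i) ↔ ((cs.wordProd ω)⁻¹ * cs.simple i * cs.wordProd ω = x.1) := by
        constructor
        · intro h; rw [← h]; group
        · intro h; rw [← h]; group
      simp only [this, beq_iff_eq]
      split_ifs <;> push_cast <;> ring

lemma sf_pow (cs : CoxeterSystem M W) (i j : B) (m : ℕ) :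
    (sf cs i * sf cs j) ^ m = ((alternatingWord j i (2 * m)).reverse.map (sf cs)).prod := by
  induction m with
  | zero => simp [alternatingWord]
  | succ m ih =>
    rw [pow_succ', ih, show 2 * (m+1) = 2 * m + 1 + 1 by ring, alternatingWord_succ, alternatingWord_succ]
    simp [mul_assoc]

lemma sf_liftable (cs : CoxeterSystem M W) : M.IsLiftable (sf cs) := by
  classical
  intro i j
  rw [sf_pow]
  funext x
  rw [sf_word]
  set m := M i j with hm
  set ω := alternatingWord j i (2 * m) with hω
  have h1 : cs.wordProd ω = 1 := by
    rw [hω, prod_alternatingWord_eq_mul_pow]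
    simp [hm, M.symmetric i j]
  have h2 : cs.wordProd ω.reverse = 1 := by simp [h1]
  have hl : (cs.leftInvSeq ω).length = 2 * m := by simp [hω]
  have h3 : (cs.leftInvSeq ω).drop m = (cs.leftInvSeq ω).take m := by
    apply List.ext_getElem
    · simp [hω]; omega
    · intro k hk hk'
      have hk2 : k < m := by simp [hω] at hk; omega
      rw [List.getElem_drop, List.getElem_take]
      have e1 := cs.getElem_leftInvSeq_alternatingWord j i m (m + k) (by omega)
      have e2 := cs.getElem_leftInvSeq_alternatingWord j i m k (by omega)
      refine e1.trans (Eq.trans ?_ e2.symm)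
      rw [prod_alternatingWord_eq_mul_pow, prod_alternatingWord_eq_mul_pow]
      have p1 : ¬ Even (2 * (m + k) + 1) := by simp
      have p2 : ¬ Even (2 * k + 1) := by simp
      rw [if_neg p1, if_neg p2]
      have q1 : (2 * (m + k) + 1) / 2 = m + k := by omega
      have q2 : (2 * k + 1) / 2 = k := by omega
      rw [q1, q2, pow_add, hm, cs.simple_mul_simple_pow, one_mul]
  have h4 : ((((cs.rightInvSeq ω.reverse).count x.1 : ℕ)) : ZMod 2) = 0 := by
    rw [rightInvSeq_reverse, List.count_reverse, ← List.take_append_drop m (cs.leftInvSeq ω), h3, List.count_append]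
    push_cast
    exact CharTwo.add_self_eq_zero _
  rw [h2, h4]
  simp
  rfl

open scoped Classical in
lemma count_parity (cs : CoxeterSystem M W) (ω ω' : List B) (h : cs.wordProd ω = cs.wordProd ω') (t : W) :
    ((((cs.rightInvSeq ω).count t : ℕ)) : ZMod 2) = (((cs.rightInvSeq ω').count t : ℕ) : ZMod 2) := by
  have key : ∀ ω : List B, cs.lift ⟨sf cs, sf_liftable cs⟩ (cs.wordProd ω) = (ω.map (sf cs)).prod := by
    intro ω
    unfold wordProd
    rw [map_list_prod, List.map_map]
    congr 2
    funext i
    exact cs.lift_apply_simple (sf_liftable cs) i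
  have h1 : (ω.map (sf cs)).prod = (ω'.map (sf cs)).prod := by rw [← key, ← key, h]
  have h2 := congrArg (fun f : Function.End (W × ZMod 2) => (f (t, 0)).2) h1
  simp only [sf_word, zero_add] at h2
  exact h2

lemma mem_ris (cs : CoxeterSystem M W) (ω : List B) (s : B) (h : cs.IsRightDescent (cs.wordProd ω) s) :
    cs.simple s ∈ cs.rightInvSeq ω := by
  classical
  obtain ⟨ω', h1, h2⟩ := cs.exists_isReduced (cs.wordProd ω * cs.simple s)
  have h3 : cs.wordProd (ω'.concat s) = cs.wordProd ω := by
    rw [wordProd_concat, ← h2]; simp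
  have h4 : cs.IsReduced (ω'.concat s) := by
    rw [isRightDescent_iff] at h
    unfold CoxeterSystem.IsReduced at h1 ⊢
    rw [h3, ← h, h2, h1]; simp
  have h5 := h4.nodup_rightInvSeq
  have h6 : cs.simple s ∈ cs.rightInvSeq (ω'.concat s) := by
    rw [rightInvSeq_concat]; simp
  have h7 := count_parity cs _ _ h3 (cs.simple s)
  rw [List.count_eq_one_of_mem h5 h6] at h7
  by_contra h8
  rw [List.count_eq_zero_of_not_mem h8] at h7
  simp at h7

/-- The exchange property. -/
lemma exchange_right (cs : CoxeterSystem M W) (ω : List B) (s : B) (h : cs.IsRightDescent (cs.wordProd ω) s) :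
    ∃ a i b, ω = a ++ i :: b ∧ cs.wordProd ω * cs.simple s = cs.wordProd (a ++ b) := by
  have h1 := mem_ris cs ω s h
  obtain ⟨j, hj, hj2⟩ := List.getElem_of_mem h1
  have hj' : j < ω.length := by simpa using hj
  have h2 := cs.wordProd_mul_getD_rightInvSeq ω j
  rw [List.getD_eq_getElem _ _ hj, hj2] at h2
  refine ⟨ω.take j, ω[j], ω.drop (j+1), ?_, ?_⟩
  · simp
  · rw [h2, List.eraseIdx_eq_take_drop_succ]

lemma exchange (cs : CoxeterSystem M W) (ω : List B) (s : B) (h : cs.IsLeftDescent (cs.wordProd ω) s) :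
    ∃ a i b, ω = a ++ i :: b ∧ cs.simple s * cs.wordProd ω = cs.wordProd (a ++ b) := by
  obtain ⟨a, i, b, h1, h2⟩ := exchange_right cs ω.reverse s (by
    rw [wordProd_reverse, isRightDescent_inv_iff]; exact h)
  refine ⟨b.reverse, i, a.reverse, ?_, ?_⟩
  · have := congrArg List.reverse h1
    simpa using this
  · have := congrArg (·⁻¹) h2
    rw [wordProd_reverse] at this
    simp only [mul_inv_rev, inv_inv, inv_simple] at this
    rw [this, ← wordProd_reverse]; simp

lemma mem_lis (cs : CoxeterSystem M W) (ω : List B) (s : B) (h : cs.IsLeftDescent (cs.wordProd ω) s) :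
    cs.simple s ∈ cs.leftInvSeq ω := by
  have := mem_ris cs ω.reverse s (by
    rw [wordProd_reverse, isRightDescent_inv_iff]; exact h)
  rw [rightInvSeq_reverse] at this
  simpa using this

/-- reduced words inside a parabolic -/
lemma parabolic_word (cs : CoxeterSystem M W) (J : Set B) (u : W) (hu : u ∈ Subgroup.closure (cs.simple '' J)) :
    ∃ ω : List B, (∀ i ∈ ω, i ∈ J) ∧ cs.wordProd ω = u ∧ cs.length u = ω.length := by
  have step : ∀ s ∈ J, ∀ u, (∃ ω : List B, (∀ i ∈ ω, i ∈ J) ∧ cs.wordProd ω = u ∧ cs.length u = ω.length) →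
      (∃ ω : List B, (∀ i ∈ ω, i ∈ J) ∧ cs.wordProd ω = cs.simple s * u ∧ cs.length (cs.simple s * u) = ω.length) := by
    rintro s hs u ⟨ω, h1, rfl, h3⟩
    by_cases hd : cs.IsLeftDescent (cs.wordProd ω) s
    · obtain ⟨a, i, b, h4, h5⟩ := exchange cs ω s hd
      refine ⟨a ++ b, ?_, h5.symm, ?_⟩
      · intro k hk; apply h1; rw [h4]; simp at hk ⊢; tauto
      · rw [isLeftDescent_iff] at hd
        rw [h4] at h3
        rw [← h4] at h3
        rw [h3, h4] at hd
        simp at hd ⊢; 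
        rw [h4]; omega
    · rw [not_isLeftDescent_iff] at hd
      refine ⟨s :: ω, ?_, by rw [wordProd_cons], by rw [hd, h3]; simp⟩
      intro k hk; rcases List.mem_cons.mp hk with rfl | hk
      · exact hs
      · exact h1 k hk
  induction hu using Subgroup.closure_induction_left with
  | one => exact ⟨[], by simp, by simp, by simp⟩
  | mul_left x hx y hy ih =>
    obtain ⟨s, hs, rfl⟩ := hx
    exact step s hs y ih
  | inv_mul_cancel x hx y hy ih =>
    obtain ⟨s, hs, rfl⟩ := hx
    rw [inv_simple]
    exact step s hs y ih

/-- The prefix order. -/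
def Pre (cs : CoxeterSystem M W) (x y : W) : Prop := cs.length x + cs.length (x⁻¹ * y) = cs.length y

lemma Pre.refl (cs : CoxeterSystem M W) (x : W) : Pre cs x x := by simp [Pre]

lemma Pre.le {cs : CoxeterSystem M W} {x y : W} (h : Pre cs x y) : cs.length x ≤ cs.length y := by
  unfold Pre at h; omega

lemma Pre.trans {cs : CoxeterSystem M W} {x y z : W} (h : Pre cs x y) (h' : Pre cs y z) : Pre cs x z := by
  unfold Pre at *
  have h1 := cs.length_mul_le (x⁻¹ * y) (y⁻¹ * z)
  have h2 := cs.length_mul_le x (x⁻¹ * z)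
  have e1 : x⁻¹ * y * (y⁻¹ * z) = x⁻¹ * z := by group
  have e2 : x * (x⁻¹ * z) = z := by group
  rw [e1] at h1
  rw [e2] at h2
  omega

lemma Pre.eq {cs : CoxeterSystem M W} {x y : W} (h : Pre cs x y) (h' : cs.length y ≤ cs.length x) : x = y := by
  unfold Pre at h
  have : cs.length (x⁻¹ * y) = 0 := by omega
  rw [length_eq_zero_iff] at this
  exact inv_mul_eq_one.mp this

lemma Pre.desc {cs : CoxeterSystem M W} {x y : W} (h : Pre cs x y) {s : B} (hs : cs.IsLeftDescent x s) :
    cs.IsLeftDescent y s := by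
  unfold Pre IsLeftDescent at *
  have h1 := cs.length_mul_le (cs.simple s * x) (x⁻¹ * y)
  have e1 : cs.simple s * x * (x⁻¹ * y) = cs.simple s * y := by group
  rw [e1] at h1
  omega

open scoped Classical in
/-- left Demazure operator -/
noncomputable def dl (cs : CoxeterSystem M W) (s : B) (x : W) : W :=
  if cs.IsLeftDescent x s then x else cs.simple s * x

open scoped Classical in
/-- right Demazure operator -/
noncomputable def dr (cs : CoxeterSystem M W) (s : B) (x : W) : W :=
  if cs.IsRightDescent x s then x else x * cs.simple s

lemma dl_dr (cs : CoxeterSystem M W) (s t : B) (x : W) : dl cs s (dr cs t x) = dr cs t (dl cs s x) := by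
  have key : ¬ cs.IsLeftDescent x s → ¬ cs.IsRightDescent x t → cs.IsLeftDescent (x * cs.simple t) s →
      cs.simple s * x = x * cs.simple t := by
    intro h1 h2 h3
    obtain ⟨ω, hr, rfl⟩ := cs.exists_isReduced x
    rw [← wordProd_concat] at h3
    obtain ⟨a, i, b, h4, h5⟩ := exchange cs _ s h3
    rw [wordProd_concat] at h5
    rcases List.eq_nil_or_concat b with rfl | ⟨b', j, rfl⟩
    · have h6 : ω = a := by
        have : ω.concat t = a.concat i := by simpa using h4
        exact List.init_eq_of_concat_eq this
      rw [List.append_nil, ← h6] at h5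
      calc _ = cs.simple s * (cs.wordProd ω * cs.simple t) * cs.simple t := by simp [mul_assoc]
        _ = _ := by rw [h5]
    · exfalso
      have h6 : ω.concat t = (a ++ i :: b').concat j := by simpa using h4
      have h7 := List.init_eq_of_concat_eq h6
      have h8 : t = j := List.last_eq_of_concat_eq h6
      have h9 : cs.simple s * cs.wordProd ω = cs.wordProd (a ++ b') := by
        have e : a ++ b'.concat j = (a ++ b').concat j := by simp
        rw [e, wordProd_concat, ← h8, ← mul_assoc] at h5
        exact mul_right_cancel h5
      rw [not_isLeftDescent_iff, h9] at h1
      have h10 := cs.length_wordProd_le (a ++ b')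
      unfold CoxeterSystem.IsReduced at hr
      rw [hr, h7] at h1
      simp at h1 h10
      omega
  by_cases h1 : cs.IsLeftDescent x s
  · have hl : dl cs s x = x := by simp [dl, h1]
    rw [hl]
    by_cases h2 : cs.IsRightDescent x t
    · simp [dr, h2, hl]
    · have : cs.IsLeftDescent (x * cs.simple t) s := by
        have a1 := cs.length_mul_le (cs.simple s * x) (cs.simple t)
        rw [not_isRightDescent_iff] at h2
        unfold IsLeftDescent at *
        rw [← mul_assoc]
        simp at a1
        omega
      simp [dr, h2, dl, this]
  · by_cases h2 : cs.IsRightDescent x t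
    · have : cs.IsRightDescent (cs.simple s * x) t := by
        have a1 := cs.length_mul_le (cs.simple s) (x * cs.simple t)
        rw [not_isLeftDescent_iff] at h1
        unfold IsRightDescent at *
        rw [mul_assoc]
        simp at a1
        omega
      simp [dr, h2, dl, h1, this]
    · by_cases h3 : cs.IsLeftDescent (x * cs.simple t) s
      · have h4 := key h1 h2 h3
        have h5 : cs.IsRightDescent (x * cs.simple t) t := by
          rw [not_isRightDescent_iff] at h2
          unfold IsRightDescent
          simp [h2]
        simp [dr, dl, h1, h2, h3, h4, h5]
      · have h4 : ¬ cs.IsRightDescent (cs.simple s * x) t := by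
          rw [not_isRightDescent_iff] at h2 ⊢
          rw [not_isLeftDescent_iff] at h1 h3
          rw [← mul_assoc] at h3
          omega
        simp [dr, dl, h1, h2, h3, h4, mul_assoc]

lemma dr_pre (cs : CoxeterSystem M W) (t : B) (x : W) : Pre cs x (dr cs t x) := by
  unfold dr
  split_ifs with h
  · exact Pre.refl cs x
  · rw [not_isRightDescent_iff] at h
    simp [Pre, h]

/-- iterated right operators -/
noncomputable def drs (cs : CoxeterSystem M W) (ω : List B) (x : W) : W := ω.foldl (fun y t => dr cs t y) x

lemma drs_pre (cs : CoxeterSystem M W) (ω : List B) (x : W) : Pre cs x (drs cs ω x) := by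
  induction ω generalizing x with
  | nil => exact Pre.refl cs x
  | cons t ω ih => exact (dr_pre cs t x).trans (ih _)

lemma dl_drs (cs : CoxeterSystem M W) (s : B) (ω : List B) (x : W) : dl cs s (drs cs ω x) = drs cs ω (dl cs s x) := by
  induction ω generalizing x with
  | nil => rfl
  | cons t ω ih =>
    change dl cs s (drs cs ω (dr cs t x)) = drs cs ω (dr cs t (dl cs s x))
    rw [ih, dl_dr]

lemma drs_reduced (cs : CoxeterSystem M W) (ω : List B) (h : cs.IsReduced ω) : drs cs ω 1 = cs.wordProd ω := by
  induction ω using List.reverseRecOn with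
  | nil => simp [drs]
  | append_singleton ω t ih =>
    have h1 : cs.IsReduced ω := by simpa using h.take ω.length
    have h2 : drs cs (ω ++ [t]) 1 = dr cs t (drs cs ω 1) := by simp [drs]
    rw [h2, ih h1]
    have h3 : ¬ cs.IsRightDescent (cs.wordProd ω) t := by
      rw [not_isRightDescent_iff]
      unfold CoxeterSystem.IsReduced at h h1
      rw [wordProd_append, wordProd_singleton] at h
      rw [h, h1]; simp
    simp [dr, h3, wordProd_append]

/-- If all elements of `J` are left descents of `p`, then every element of the parabolic is a prefix. -/
lemma parabolic_pre (cs : CoxeterSystem M W) (J : Set B) (p : W) (hJ : ∀ s ∈ J, cs.IsLeftDescent p s)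
    (u : W) (hu : u ∈ Subgroup.closure (cs.simple '' J)) : Pre cs u p := by
  obtain ⟨ω, hω, hp⟩ := cs.exists_isReduced p
  have h0 := drs_reduced cs ω hω
  rw [← hp] at h0
  obtain ⟨v, hv1, hv2, hv3⟩ := parabolic_word cs J u hu
  have key : ∀ v : List B, (∀ i ∈ v, i ∈ J) → cs.IsReduced v → drs cs ω (cs.wordProd v) = p := by
    intro v
    induction v with
    | nil => intro _ _; simpa using h0
    | cons s v ih =>
      intro h1 h2
      have h3 : cs.IsReduced v := by simpa using h2.drop 1
      have h4 := ih (fun i hi => h1 i (by simp [hi])) h3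
      have h5 : dl cs s (cs.wordProd v) = cs.wordProd (s :: v) := by
        have : ¬ cs.IsLeftDescent (cs.wordProd v) s := by
          rw [not_isLeftDescent_iff]
          unfold CoxeterSystem.IsReduced at h2 h3
          rw [wordProd_cons] at h2
          rw [h2, h3]; simp
        simp [dl, this, wordProd_cons]
      rw [← h5, ← dl_drs, h4]
      simp [dl, hJ s (h1 s (by simp))]
  have h6 := key v hv1 (by unfold CoxeterSystem.IsReduced; rw [hv2, hv3])
  rw [hv2] at h6
  have h7 := drs_pre cs ω u
  rwa [h6] at h7

lemma finite_pre (cs : CoxeterSystem M W) : ∀ (n : ℕ) (p : W), cs.length p = n → {u | Pre cs u p}.Finite := by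
  intro n
  induction n with
  | zero =>
    intro p hp
    refine (Set.finite_singleton (1 : W)).subset ?_
    intro u hu
    have := Pre.le hu
    rw [hp] at this
    exact (cs.length_eq_zero_iff).mp (by omega)
  | succ n ih =>
    intro p hp
    obtain ⟨ω, hω, hp'⟩ := cs.exists_isReduced p
    have hfin : (cs.simple '' {s | cs.IsLeftDescent p s}).Finite := by
      refine (List.finite_toSet (cs.leftInvSeq ω)).subset ?_
      rintro _ ⟨s, hs, rfl⟩
      exact mem_lis cs ω s (by rw [← hp']; exact hs)
    have hfin2 : (⋃ t ∈ cs.simple '' {s | cs.IsLeftDescent p s}, (fun u => t * u) '' {u | Pre cs u (t * p)}).Finite := by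
      refine hfin.biUnion ?_
      rintro _ ⟨s, hs, rfl⟩
      refine (ih _ ?_).image _
      have := cs.isLeftDescent_iff.mp hs
      omega
    refine (hfin2.union (Set.finite_singleton 1)).subset ?_
    intro u hu
    by_cases h1 : u = 1
    · right; exact h1
    · left
      obtain ⟨s, hs⟩ := cs.exists_leftDescent_of_ne_one h1
      have hsp := Pre.desc hu hs
      refine Set.mem_biUnion ⟨s, hsp, rfl⟩ ⟨cs.simple s * u, ?_, by simp⟩
      have hu' : Pre cs u p := hu
      change Pre cs _ _
      have e : (cs.simple s * u)⁻¹ * (cs.simple s * p) = u⁻¹ * p := by group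
      unfold Pre at hu' ⊢
      rw [e]
      have a1 := cs.isLeftDescent_iff.mp hs
      have a2 := cs.isLeftDescent_iff.mp hsp
      omega

lemma finite_parabolic (cs : CoxeterSystem M W) (x : W) :
    (Subgroup.closure (cs.simple '' {s | cs.IsLeftDescent x s}) : Set W).Finite :=
  (finite_pre cs _ x rfl).subset fun u hu => parabolic_pre cs _ x (fun _ h => h) u hu

/-- The element `Δ_{L(x)}`. -/
lemma exists_delta (cs : CoxeterSystem M W) (x : W) :
    ∃ d, d ∈ Subgroup.closure (cs.simple '' {s | cs.IsLeftDescent x s}) ∧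
      ∀ s, cs.IsLeftDescent x s → cs.IsLeftDescent d s := by
  obtain ⟨d, hd, hmax⟩ := (finite_parabolic cs x).exists_maximalFor cs.length _ ⟨1, Subgroup.one_mem _⟩
  refine ⟨d, hd, fun s hs => ?_⟩
  by_contra h
  rw [not_isLeftDescent_iff] at h
  have h1 : cs.simple s * d ∈ (Subgroup.closure (cs.simple '' {s | cs.IsLeftDescent x s}) : Set W) :=
    Subgroup.mul_mem _ (Subgroup.subset_closure ⟨s, hs, rfl⟩) hd
  have := hmax h1 (by omega)
  omega

noncomputable def delta (cs : CoxeterSystem M W) (x : W) : W := (exists_delta cs x).choose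

lemma delta_mem (cs : CoxeterSystem M W) (x : W) :
    delta cs x ∈ Subgroup.closure (cs.simple '' {s | cs.IsLeftDescent x s}) := (exists_delta cs x).choose_spec.1

lemma delta_desc (cs : CoxeterSystem M W) (x : W) (s : B) (h : cs.IsLeftDescent x s) :
    cs.IsLeftDescent (delta cs x) s := (exists_delta cs x).choose_spec.2 s h

lemma delta_pre (cs : CoxeterSystem M W) (x : W) : Pre cs (delta cs x) x :=
  parabolic_pre cs _ x (fun _ h => h) _ (delta_mem cs x)

lemma delta_mono (cs : CoxeterSystem M W) {x y : W} (h : Pre cs x y) : Pre cs (delta cs x) (delta cs y) := by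
  refine parabolic_pre cs {s | cs.IsLeftDescent x s} _ (fun s hs => delta_desc cs y s (h.desc hs)) _ (delta_mem cs x)

end Cox
section Pos

lemma Pre.mul {cs : CoxeterSystem M W} {a y z : W} (h : cs.length (a * y) = cs.length a + cs.length y)
    (hz : Pre cs z y) : cs.length (a * z) = cs.length a + cs.length z := by
  unfold Pre at hz
  have h1 := cs.length_mul_le (a * z) (z⁻¹ * y)
  have h2 := cs.length_mul_le a z
  have e : a * z * (z⁻¹ * y) = a * y := by group
  rw [e] at h1
  omega

lemma Pre.mul_left {cs : CoxeterSystem M W} {a x y z : W} (h : cs.length (a * y) = cs.length a + cs.length y)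
    (hz : Pre cs z y) (hx : Pre cs x z) : Pre cs (a * x) (a * z) := by
  have h1 := Pre.mul h hz
  have h2 := Pre.mul h (hx.trans hz)
  unfold Pre at *
  have e : (a * x)⁻¹ * (a * z) = x⁻¹ * z := by group
  rw [e]
  omega

lemma Pre.self_mul {cs : CoxeterSystem M W} {a y : W} (h : cs.length (a * y) = cs.length a + cs.length y) :
    Pre cs a (a * y) := by
  unfold Pre
  rw [inv_mul_cancel_left, h]

lemma Pre.antisymm {cs : CoxeterSystem M W} {x y : W} (h : Pre cs x y) (h' : Pre cs y x) : x = y := h.eq h'.le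

/-- reduced factorization -/
def Red (cs : CoxeterSystem M W) (l : List W) : Prop := (l.map cs.length).sum = cs.length l.prod

lemma length_prod_le (cs : CoxeterSystem M W) (l : List W) : cs.length l.prod ≤ (l.map cs.length).sum := by
  induction l with
  | nil => simp
  | cons a l ih =>
    have := cs.length_mul_le a l.prod
    simp
    omega

lemma Red.append {cs : CoxeterSystem M W} {l l' : List W} (h : Red cs (l ++ l')) :
    Red cs l ∧ Red cs l' ∧ cs.length (l.prod * l'.prod) = cs.length l.prod + cs.length l'.prod := by
  unfold Red at *
  have h1 := length_prod_le cs l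
  have h2 := length_prod_le cs l'
  have h3 := cs.length_mul_le l.prod l'.prod
  simp at h
  omega

lemma Red.cons {cs : CoxeterSystem M W} {a : W} {l : List W} (h : Red cs (a :: l)) :
    Red cs l ∧ cs.length (a * l.prod) = cs.length a + cs.length l.prod := by
  have := Red.append (l := [a]) (l' := l) h
  simpa using this.2

open scoped Classical in
/-- partial products -/
noncomputable def pp : List W → Finset W
  | [] => ∅
  | a :: l => insert a ((pp l).image (a * ·))

lemma mem_pp_cons {a x : W} {l : List W} : x ∈ pp (a :: l) ↔ x = a ∨ ∃ z ∈ pp l, a * z = x := by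
  simp only [pp, Finset.mem_insert, Finset.mem_image]

lemma mem_pp_append {x : W} {l l' : List W} : x ∈ pp (l ++ l') ↔ x ∈ pp l ∨ ∃ z ∈ pp l', l.prod * z = x := by
  induction l generalizing x with
  | nil => simp [pp]
  | cons a l ih =>
    rw [List.cons_append, mem_pp_cons, mem_pp_cons]
    simp only [ih, List.prod_cons, mul_assoc]
    constructor
    · rintro (h | ⟨z, h | ⟨y, hy, rfl⟩, rfl⟩)
      · exact Or.inl (Or.inl h)
      · exact Or.inl (Or.inr ⟨z, h, rfl⟩)
      · exact Or.inr ⟨y, hy, rfl⟩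
    · rintro ((h | ⟨z, h, rfl⟩) | ⟨z, h, rfl⟩)
      · exact Or.inl h
      · exact Or.inr ⟨z, Or.inl h, rfl⟩
      · exact Or.inr ⟨_, Or.inr ⟨z, h, rfl⟩, rfl⟩

lemma prod_mem_pp {l : List W} (h : l ≠ []) : l.prod ∈ pp l := by
  induction l with
  | nil => exact absurd rfl h
  | cons a l ih =>
    rw [mem_pp_cons]
    by_cases hl : l = []
    · left; simp [hl]
    · right; exact ⟨l.prod, ih hl, by simp⟩

lemma exists_split {l : List W} {x : W} (h : x ∈ pp l) : ∃ b r, l = b ++ r ∧ b ≠ [] ∧ b.prod = x := by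
  induction l generalizing x with
  | nil => simp [pp] at h
  | cons a l ih =>
    rcases mem_pp_cons.mp h with rfl | ⟨z, hz, rfl⟩
    · exact ⟨[x], l, by simp⟩
    · obtain ⟨b, r, rfl, hb, rfl⟩ := ih hz
      exact ⟨a :: b, r, by simp⟩

lemma pp_pre {cs : CoxeterSystem M W} {l : List W} (hl : Red cs l) {x : W} (h : x ∈ pp l) : Pre cs x l.prod := by
  obtain ⟨b, r, rfl, hb, rfl⟩ := exists_split h
  rw [List.prod_append]
  exact Pre.self_mul hl.append.2.2

lemma pp_chain {cs : CoxeterSystem M W} {l : List W} (hl : Red cs l) {x y : W} (hx : x ∈ pp l) (hy : y ∈ pp l) :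
    Pre cs x y ∨ Pre cs y x := by
  induction l generalizing x y with
  | nil => simp [pp] at hx
  | cons a l ih =>
    obtain ⟨h1, h2⟩ := hl.cons
    rcases mem_pp_cons.mp hx with ex | ⟨x', hx', rfl⟩ <;> rcases mem_pp_cons.mp hy with ey | ⟨y', hy', rfl⟩
    · left; rw [ex, ey]; exact Pre.refl cs _
    · left; rw [ex]; exact Pre.self_mul (Pre.mul h2 (pp_pre h1 hy'))
    · right; rw [ey]; exact Pre.self_mul (Pre.mul h2 (pp_pre h1 hx'))
    · rcases ih h1 hx' hy' with h | h
      · left; exact Pre.mul_left h2 (pp_pre h1 hy') h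
      · right; exact Pre.mul_left h2 (pp_pre h1 hx') h

lemma pp_head {cs : CoxeterSystem M W} {l : List W} (hl : Red cs l) (hne : l ≠ []) :
    l.head hne ∈ pp l ∧ ∀ y ∈ pp l, Pre cs (l.head hne) y := by
  cases l with
  | nil => exact absurd rfl hne
  | cons a l =>
    obtain ⟨h1, h2⟩ := hl.cons
    refine ⟨mem_pp_cons.mpr (Or.inl rfl), fun y hy => ?_⟩
    rcases mem_pp_cons.mp hy with rfl | ⟨y, hy', rfl⟩
    · exact Pre.refl cs _
    · exact Pre.self_mul (Pre.mul h2 (pp_pre h1 hy'))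

lemma one_notMem_pp {cs : CoxeterSystem M W} {l : List W} (hl : Red cs l) (h1 : ∀ v ∈ l, v ≠ 1) : (1 : W) ∉ pp l := by
  intro h
  have hne : l ≠ [] := by rintro rfl; simp [pp] at h
  have h2 := ((pp_head hl hne).2 1 h).le
  simp only [length_one, nonpos_iff_eq_zero, length_eq_zero_iff] at h2
  exact h1 _ (List.head_mem hne) h2

lemma pp_flatten (L : List (List W)) (h : ∀ b ∈ L, b ≠ []) : pp (L.map List.prod) ⊆ pp L.flatten := by
  induction L with
  | nil => simp [pp]
  | cons b L ih =>
    intro x hx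
    rw [List.flatten_cons, mem_pp_append]
    rw [List.map_cons, mem_pp_cons] at hx
    rcases hx with rfl | ⟨z, hz, rfl⟩
    · left; exact prod_mem_pp (h b (by simp))
    · right; exact ⟨z, ih (fun b hb => h b (by simp [hb])) hz, rfl⟩

lemma pp_of_refines {l l' : List W} (h : ListRefines l l') (h1 : ∀ v ∈ l', v ≠ 1) : pp l' ⊆ pp l := by
  obtain ⟨L, rfl, rfl⟩ := h
  apply pp_flatten
  rintro b hb rfl
  exact h1 1 (List.mem_map.mpr ⟨[], hb, rfl⟩) rfl

lemma refines_of_pp {cs : CoxeterSystem M W} {l l' : List W} (hl : Red cs l) (hl' : Red cs l')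
    (h1 : ∀ v ∈ l, v ≠ 1) (h1' : ∀ v ∈ l', v ≠ 1) (hp : l.prod = l'.prod) (h : pp l' ⊆ pp l) : ListRefines l l' := by
  induction l' generalizing l with
  | nil =>
    have : l = [] := by
      by_contra hne
      have := prod_mem_pp hne
      rw [hp] at this
      exact one_notMem_pp hl h1 this
    subst this
    exact ⟨[], rfl, rfl⟩
  | cons a l' ih =>
    obtain ⟨b, r, rfl, hb, rfl⟩ := exists_split (h (mem_pp_cons.mpr (Or.inl rfl)))
    obtain ⟨hb1, hr1, hbr⟩ := hl.append
    obtain ⟨hl1, hl2⟩ := hl'.cons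
    have hp' : r.prod = l'.prod := by
      rw [List.prod_append, List.prod_cons] at hp
      exact mul_left_cancel hp
    obtain ⟨L, hL1, hL2⟩ := ih hr1 hl1 (fun v hv => h1 v (by simp [hv])) (fun v hv => h1' v (by simp [hv])) hp' (by
      intro z hz
      have h2 := h (mem_pp_cons.mpr (Or.inr ⟨z, hz, rfl⟩))
      rcases mem_pp_append.mp h2 with h3 | ⟨y, hy, h3⟩
      · exfalso
        have h4 := (pp_pre hb1 h3).le
        have h5 := Pre.mul hl2 (pp_pre hl1 hz)
        have h6 : cs.length z = 0 := by omega
        rw [length_eq_zero_iff] at h6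
        subst h6
        exact one_notMem_pp hl1 (fun v hv => h1' v (by simp [hv])) hz
      · rw [← mul_left_cancel h3]; exact hy)
    exact ⟨b :: L, by simp [hL1], by simp [hL2]⟩

lemma exists_min_pre (cs : CoxeterSystem M W) (c : Finset W) (hne : c.Nonempty)
    (hc : ∀ x ∈ c, ∀ y ∈ c, Pre cs x y ∨ Pre cs y x) : ∃ x ∈ c, ∀ y ∈ c, Pre cs x y := by
  obtain ⟨x, hx, hmin⟩ := c.exists_min_image cs.length hne
  refine ⟨x, hx, fun y hy => ?_⟩
  rcases hc x hx y hy with h | h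
  · exact h
  · rw [h.eq (hmin y hy)]; exact Pre.refl cs x

lemma Pre.inv_mul {cs : CoxeterSystem M W} {x y z : W} (h1 : Pre cs x y) (h2 : Pre cs y z) :
    Pre cs (x⁻¹ * y) (x⁻¹ * z) := by
  have h3 := h1.trans h2
  unfold Pre at *
  have e : (x⁻¹ * y)⁻¹ * (x⁻¹ * z) = y⁻¹ * z := by group
  rw [e]
  omega

lemma pp_surj (cs : CoxeterSystem M W) (n : ℕ) : ∀ (c : Finset W) (w : W), c.card = n → w ∈ c →
    (∀ x ∈ c, ∀ y ∈ c, Pre cs x y ∨ Pre cs y x) → (∀ y ∈ c, Pre cs y w) → (1 : W) ∉ c →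
    ∃ l : List W, l ≠ [] ∧ l.prod = w ∧ Red cs l ∧ (∀ v ∈ l, v ≠ 1) ∧ pp l = c := by
  classical
  induction n with
  | zero =>
    intro c w h hw
    rw [Finset.card_eq_zero] at h
    simp [h] at hw
  | succ n ih =>
    intro c w hn hw hc hcw h1
    obtain ⟨x, hx, hmin⟩ := exists_min_pre cs c ⟨w, hw⟩ hc
    have hx1 : x ≠ 1 := by rintro rfl; exact h1 hx
    by_cases hxw : x = w
    · subst hxw
      refine ⟨[x], by simp, by simp, by simp [Red], by simpa using hx1, ?_⟩
      ext y
      rw [mem_pp_cons]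
      simp only [pp, Finset.notMem_empty, false_and, exists_false, or_false]
      constructor
      · rintro rfl; exact hx
      · intro hy; exact (hcw y hy).antisymm (hmin y hy)
    · obtain ⟨l, hl0, hl1, hl2, hl3, hl4⟩ := ih ((c.erase x).image (x⁻¹ * ·)) (x⁻¹ * w) (by
          rw [Finset.card_image_of_injective _ (mul_right_injective _), Finset.card_erase_of_mem hx, hn]; rfl)
        (Finset.mem_image.mpr ⟨w, Finset.mem_erase.mpr ⟨fun h => hxw h.symm, hw⟩, rfl⟩)
        (by
          intro a ha b hb
          obtain ⟨a, ha', rfl⟩ := Finset.mem_image.mp ha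
          replace ha := ha'
          obtain ⟨b, hb', rfl⟩ := Finset.mem_image.mp hb
          replace hb := hb'
          have ha := Finset.mem_of_mem_erase ha
          have hb := Finset.mem_of_mem_erase hb
          rcases hc a ha b hb with h | h
          · left; exact Pre.inv_mul (hmin a ha) h
          · right; exact Pre.inv_mul (hmin b hb) h)
        (by
          intro a ha
          obtain ⟨a, ha', rfl⟩ := Finset.mem_image.mp ha
          replace ha := ha'
          have ha := Finset.mem_of_mem_erase ha
          exact Pre.inv_mul (hmin a ha) (hcw a ha))
        (by
          intro h
          obtain ⟨a, ha, h⟩ := Finset.mem_image.mp h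
          exact (Finset.mem_erase.mp ha).1 (inv_mul_eq_one.mp h).symm)
      refine ⟨x :: l, by simp, by simp [hl1], ?_, ?_, ?_⟩
      · unfold Red at hl2 ⊢
        have := hcw x hx
        unfold Pre at this
        rw [List.map_cons, List.sum_cons, hl2, List.prod_cons, hl1, mul_inv_cancel_left, this]
      · intro v hv
        rcases List.mem_cons.mp hv with rfl | hv
        · exact hx1
        · exact hl3 v hv
      · ext y
        rw [mem_pp_cons, hl4]
        constructor
        · rintro (rfl | ⟨z, hz, rfl⟩)
          · exact hx
          · obtain ⟨a, ha, rfl⟩ := Finset.mem_image.mp hz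
            simpa using Finset.mem_of_mem_erase ha
        · intro hy
          by_cases hyx : y = x
          · exact Or.inl hyx
          · right
            exact ⟨x⁻¹ * y, Finset.mem_image.mpr ⟨y, Finset.mem_erase.mpr ⟨hyx, hy⟩, rfl⟩, by simp⟩

/-- admissible first letters -/
def Good (cs : CoxeterSystem M W) (s : B) (x : W) : Prop :=
  (∃ T : Set B, (Subgroup.closure (cs.simple '' T) : Set W).Finite ∧ x ∈ Subgroup.closure (cs.simple '' T)) ∧
  cs.IsLeftDescent x s ∧ ∃ s' : B, s' ≠ s ∧ cs.IsLeftDescent x s'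

lemma good_delta (cs : CoxeterSystem M W) (s : B) (x : W) (h : cs.IsLeftDescent x s)
    (h' : ∃ s' : B, s' ≠ s ∧ cs.IsLeftDescent x s') : Good cs s (delta cs x) := by
  obtain ⟨s', h1, h2⟩ := h'
  exact ⟨⟨_, finite_parabolic cs x, delta_mem cs x⟩, delta_desc cs x s h, s', h1, delta_desc cs x s' h2⟩

lemma Good.length_pos {cs : CoxeterSystem M W} {s : B} {x : W} (h : Good cs s x) : 0 < cs.length x := by
  have := h.2.1
  unfold IsLeftDescent at this
  omega

/-- chains of prefixes -/
def IsChn (cs : CoxeterSystem M W) (c : Finset W) : Prop := ∀ x ∈ c, ∀ y ∈ c, Pre cs x y ∨ Pre cs y x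

/-- The poset of chains of prefixes, under reverse inclusion. -/
structure Ch (cs : CoxeterSystem M W) (s : B) (w : W) where
  c : Finset W
  chain : IsChn cs c
  mem : w ∈ c
  le : ∀ y ∈ c, Pre cs y w
  min : ∃ x ∈ c, Good cs s x ∧ ∀ y ∈ c, Pre cs x y

instance (cs : CoxeterSystem M W) (s : B) (w : W) : Preorder (Ch cs s w) where
  le a b := b.c ⊆ a.c
  le_refl _ := Finset.Subset.refl _
  le_trans _ _ _ h h' := Finset.Subset.trans h' h

/-- factorizations give chains -/
noncomputable def toCh (cs : CoxeterSystem M W) (s : B) (w : W) : WordS1f cs s w →o Ch cs s w where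
  toFun v :=
    have hr : Red cs v.letters := by unfold Red; rw [v.prod_eq]; exact v.reduced
    { c := pp v.letters
      chain := fun _ hx _ hy => pp_chain hr hx hy
      mem := by have := prod_mem_pp v.nonempty; rwa [v.prod_eq] at this
      le := fun y hy => by have := pp_pre hr hy; rwa [v.prod_eq] at this
      min := ⟨_, (pp_head hr v.nonempty).1, ⟨v.first_finite, v.first_descent, v.first_two_descents⟩,
        (pp_head hr v.nonempty).2⟩ }
  monotone' := by
    intro v v' h
    change pp v'.letters ⊆ pp v.letters
    have h' : Relation.ReflTransGen (fun x y : WordS1f cs s w => ListRefines x.letters y.letters) v v' := h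
    induction h' with
    | refl => exact Finset.Subset.refl _
    | tail h1 h2 ih => exact (pp_of_refines h2 (WordS1f.ne_one _)).trans (ih h1)

lemma le_of_pp {cs : CoxeterSystem M W} {s : B} {w : W} (v v' : WordS1f cs s w) (h : pp v'.letters ⊆ pp v.letters) :
    v ≤ v' := by
  have hr : Red cs v.letters := by unfold Red; rw [v.prod_eq]; exact v.reduced
  have hr' : Red cs v'.letters := by unfold Red; rw [v'.prod_eq]; exact v'.reduced
  exact Relation.ReflTransGen.single (refines_of_pp hr hr' v.ne_one v'.ne_one (by rw [v.prod_eq, v'.prod_eq]) h)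

lemma exists_word (cs : CoxeterSystem M W) (s : B) (w : W) (c : Ch cs s w) : ∃ v : WordS1f cs s w, pp v.letters = c.c := by
  obtain ⟨x, hx, hg, hmin⟩ := c.min
  obtain ⟨l, hl0, hl1, hl2, hl3, hl4⟩ := pp_surj cs _ c.c w rfl c.mem c.chain c.le (by
    intro h
    have h1 := (hmin 1 h).le
    have := hg.length_pos
    simp at h1
    subst h1
    simp at this)
  have hh : l.head hl0 = x := by
    have h1 := pp_head hl2 hl0
    rw [hl4] at h1
    exact (h1.2 x hx).antisymm (hmin _ h1.1)
  exact ⟨⟨l, hl0, hl1, by unfold Red at hl2; rw [hl2, hl1], hl3, by rw [hh]; exact hg.1, by rw [hh]; exact hg.2.1,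
    by rw [hh]; exact hg.2.2⟩, hl4⟩

/-- chains give factorizations -/
noncomputable def ofCh (cs : CoxeterSystem M W) (s : B) (w : W) : Ch cs s w →o WordS1f cs s w where
  toFun c := (exists_word cs s w c).choose
  monotone' := by
    intro c d h
    apply le_of_pp
    rw [(exists_word cs s w c).choose_spec, (exists_word cs s w d).choose_spec]
    exact h

lemma id_le_ofCh_toCh (cs : CoxeterSystem M W) (s : B) (w : W) :
    (OrderHom.id : WordS1f cs s w →o WordS1f cs s w) ≤ (ofCh cs s w).comp (toCh cs s w) := by
  intro v
  apply le_of_pp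
  exact (exists_word cs s w (toCh cs s w v)).choose_spec.subset

/-- chains of good prefixes -/
def GC (cs : CoxeterSystem M W) (s : B) (w : W) (G : Finset W) : Prop :=
  G.Nonempty ∧ IsChn cs G ∧ ∀ x ∈ G, Good cs s x ∧ Pre cs x w

open scoped Classical in
/-- self maps of the chain poset from operations on good chains -/
noncomputable def selfMap (cs : CoxeterSystem M W) (s : B) (w : W) (F : Finset W → Finset W) (hm : Monotone F)
    (hF : ∀ G, GC cs s w G → GC cs s w (F G)) : Ch cs s w →o Ch cs s w where
  toFun c :=
    have h1 : GC cs s w (F (c.c.filter (Good cs s))) := hF _ (by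
      obtain ⟨x, hx, hg, hmin⟩ := c.min
      refine ⟨⟨x, Finset.mem_filter.mpr ⟨hx, hg⟩⟩, ?_, ?_⟩
      · intro y hy z hz
        exact c.chain y (Finset.mem_filter.mp hy).1 z (Finset.mem_filter.mp hz).1
      · intro y hy
        exact ⟨(Finset.mem_filter.mp hy).2, c.le y (Finset.mem_filter.mp hy).1⟩)
    { c := insert w (F (c.c.filter (Good cs s)))
      chain := by
        intro x hx y hy
        rcases Finset.mem_insert.mp hx with rfl | hx
        · right
          rcases Finset.mem_insert.mp hy with rfl | hy
          · exact Pre.refl cs _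
          · exact (h1.2.2 y hy).2
        · rcases Finset.mem_insert.mp hy with rfl | hy
          · left; exact (h1.2.2 x hx).2
          · exact h1.2.1 x hx y hy
      mem := Finset.mem_insert_self _ _
      le := by
        intro y hy
        rcases Finset.mem_insert.mp hy with rfl | hy
        · exact Pre.refl cs _
        · exact (h1.2.2 y hy).2
      min := by
        obtain ⟨x, hx, hmin⟩ := exists_min_pre cs _ h1.1 h1.2.1
        refine ⟨x, Finset.mem_insert_of_mem hx, (h1.2.2 x hx).1, ?_⟩
        intro y hy
        rcases Finset.mem_insert.mp hy with rfl | hy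
        · exact (h1.2.2 x hx).2
        · exact hmin y hy }
  monotone' := by
    intro c d h
    exact Finset.insert_subset_insert _ (hm (Finset.filter_subset_filter _ h))

lemma selfMap_le {cs : CoxeterSystem M W} {s : B} {w : W} {F F' : Finset W → Finset W} {hm hF hm' hF'}
    (h : ∀ G, F' G ⊆ F G) : selfMap cs s w F hm hF ≤ selfMap cs s w F' hm' hF' := by
  classical
  intro c
  exact Finset.insert_subset_insert _ (h _)

open scoped Classical in
/-- replace short elements by their Garside elements -/
noncomputable def hI (cs : CoxeterSystem M W) (i : ℕ) (x : W) : W := if cs.length x ≤ i then delta cs x else x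

lemma hI_mono (cs : CoxeterSystem M W) (i : ℕ) {x y : W} (h : Pre cs x y) : Pre cs (hI cs i x) (hI cs i y) := by
  have := h.le
  unfold hI
  split_ifs with h1 h2 h2
  · exact delta_mono cs h
  · exact (delta_pre cs x).trans h
  · omega
  · exact h

lemma hI_succ (cs : CoxeterSystem M W) (i : ℕ) {x : W} (h : cs.length x ≠ i + 1) : hI cs (i+1) x = hI cs i x := by
  unfold hI
  have : cs.length x ≤ i + 1 ↔ cs.length x ≤ i := by omega
  simp only [this]

lemma hI_good {cs : CoxeterSystem M W} {s : B} {w : W} (i : ℕ) {x : W} (h : Good cs s x ∧ Pre cs x w) :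
    Good cs s (hI cs i x) ∧ Pre cs (hI cs i x) w := by
  unfold hI
  split_ifs
  · exact ⟨good_delta cs s x h.1.2.1 h.1.2.2, (delta_pre cs x).trans h.2⟩
  · exact h

lemma hI_cross (cs : CoxeterSystem M W) (i : ℕ) {x y : W} (h : Pre cs x y ∨ Pre cs y x) :
    Pre cs (hI cs i x) (hI cs (i+1) y) ∨ Pre cs (hI cs (i+1) y) (hI cs i x) := by
  by_cases hx : cs.length x = i + 1
  · by_cases hy : cs.length y = i + 1
    · have hxy : x = y := by
        rcases h with h | h
        · exact h.eq (by omega)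
        · exact (h.eq (by omega)).symm
      subst hxy
      right
      unfold hI
      rw [if_pos (by omega), if_neg (by omega)]
      exact delta_pre cs x
    · rw [hI_succ cs i hy]
      exact h.imp (hI_mono cs i) (hI_mono cs i)
  · rw [← hI_succ cs i hx]
    exact h.imp (hI_mono cs _) (hI_mono cs _)

open scoped Classical in
lemma GC_image {cs : CoxeterSystem M W} {s : B} {w : W} (i : ℕ) (G : Finset W) (h : GC cs s w G) :
    GC cs s w (G.image (hI cs i)) := by
  refine ⟨h.1.image _, ?_, ?_⟩
  · intro a ha b hb
    obtain ⟨a, ha', rfl⟩ := Finset.mem_image.mp ha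
    replace ha := ha'
    obtain ⟨b, hb', rfl⟩ := Finset.mem_image.mp hb
    replace hb := hb'
    exact (h.2.1 a ha b hb).imp (hI_mono cs i) (hI_mono cs i)
  · intro a ha
    obtain ⟨a, ha', rfl⟩ := Finset.mem_image.mp ha
    replace ha := ha'
    exact hI_good i (h.2.2 a ha)

open scoped Classical in
lemma GC_union {cs : CoxeterSystem M W} {s : B} {w : W} (i : ℕ) (G : Finset W) (h : GC cs s w G) :
    GC cs s w (G.image (hI cs i) ∪ G.image (hI cs (i+1))) := by
  have h1 := GC_image i G h
  have h2 := GC_image (i+1) G h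
  refine ⟨h1.1.mono Finset.subset_union_left, ?_, ?_⟩
  · intro a ha b hb
    rcases Finset.mem_union.mp ha with ha | ha <;> rcases Finset.mem_union.mp hb with hb | hb
    · exact h1.2.1 a ha b hb
    · obtain ⟨a, ha', rfl⟩ := Finset.mem_image.mp ha
      replace ha := ha'
      obtain ⟨b, hb', rfl⟩ := Finset.mem_image.mp hb
      replace hb := hb'
      exact hI_cross cs i (h.2.1 a ha b hb)
    · obtain ⟨a, ha', rfl⟩ := Finset.mem_image.mp ha
      replace ha := ha'
      obtain ⟨b, hb', rfl⟩ := Finset.mem_image.mp hb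
      replace hb := hb'
      exact (hI_cross cs i (h.2.1 b hb a ha)).symm
    · exact h2.2.1 a ha b hb
  · intro a ha
    rcases Finset.mem_union.mp ha with ha | ha
    · exact h1.2.2 a ha
    · exact h2.2.2 a ha

open scoped Classical in
/-- the stages of the deformation -/
noncomputable def stage (cs : CoxeterSystem M W) (s : B) (w : W) (i : ℕ) : Ch cs s w →o Ch cs s w :=
  selfMap cs s w (fun G => G.image (hI cs i)) (fun _ _ h => Finset.image_subset_image h) (GC_image i)

lemma stage_succ (cs : CoxeterSystem M W) (s : B) (w : W) (i : ℕ) : Ht (stage cs s w i) (stage cs s w (i+1)) := by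
  classical
  let U : Ch cs s w →o Ch cs s w := selfMap cs s w (fun G => G.image (hI cs i) ∪ G.image (hI cs (i+1)))
    (fun _ _ h => Finset.union_subset_union (Finset.image_subset_image h) (Finset.image_subset_image h)) (GC_union i)
  have h1 : U ≤ stage cs s w i := selfMap_le fun G => Finset.subset_union_left
  have h2 : U ≤ stage cs s w (i+1) := selfMap_le fun G => Finset.subset_union_right
  exact (Ht.of_le h1).symm.trans (Ht.of_le h2)

lemma id_ht_stage (cs : CoxeterSystem M W) (s : B) (w : W) (i : ℕ) : Ht OrderHom.id (stage cs s w i) := by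
  classical
  induction i with
  | zero =>
    apply Ht.of_le
    intro c
    change insert w _ ⊆ c.c
    intro x hx
    rcases Finset.mem_insert.mp hx with hxw | hx
    · rw [hxw]; exact c.mem
    · obtain ⟨x, hx', rfl⟩ := Finset.mem_image.mp hx
      replace hx := hx'
      obtain ⟨hx1, hx2⟩ := Finset.mem_filter.mp hx
      have := hx2.length_pos
      unfold hI
      rw [if_neg (by omega)]
      exact hx1
  | succ i ih => exact ih.trans (stage_succ cs s w i)

lemma exists_const (cs : CoxeterSystem M W) (s : B) (w : W) (hs : cs.IsLeftDescent w s)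
    (htwo : ∃ s' : B, s' ≠ s ∧ cs.IsLeftDescent w s') :
    ∃ c : Ch cs s w, Ht (stage cs s w (cs.length w)) (OrderHom.const _ c) := by
  classical
  have hg : Good cs s (delta cs w) ∧ Pre cs (delta cs w) w := ⟨good_delta cs s w hs htwo, delta_pre cs w⟩
  let c0 : Ch cs s w :=
    { c := {delta cs w, w}
      chain := by
        intro x hx y hy
        simp only [Finset.mem_insert, Finset.mem_singleton] at hx hy
        rcases hx with rfl | rfl <;> rcases hy with rfl | rfl
        · left; exact Pre.refl cs _
        · left; exact hg.2
        · right; exact hg.2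
        · left; exact Pre.refl cs _
      mem := by simp
      le := by
        intro y hy
        simp only [Finset.mem_insert, Finset.mem_singleton] at hy
        rcases hy with rfl | rfl
        · exact hg.2
        · exact Pre.refl cs _
      min := by
        refine ⟨delta cs w, by simp, hg.1, ?_⟩
        intro y hy
        simp only [Finset.mem_insert, Finset.mem_singleton] at hy
        rcases hy with rfl | rfl
        · exact Pre.refl cs _
        · exact hg.2 }
  have hD : ∀ x, Pre cs x w → Pre cs (hI cs (cs.length w) x) (delta cs w) := by
    intro x hx
    unfold hI
    rw [if_pos hx.le]
    exact delta_mono cs hx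
  let V : Ch cs s w →o Ch cs s w := selfMap cs s w (fun G => insert (delta cs w) (G.image (hI cs (cs.length w))))
    (fun _ _ h => Finset.insert_subset_insert _ (Finset.image_subset_image h)) (by
      intro G h
      have h1 := GC_image (cs.length w) G h
      refine ⟨Finset.insert_nonempty _ _, ?_, ?_⟩
      · intro a ha b hb
        rcases Finset.mem_insert.mp ha with rfl | ha <;> rcases Finset.mem_insert.mp hb with rfl | hb
        · left; exact Pre.refl cs _
        · obtain ⟨b, hb', rfl⟩ := Finset.mem_image.mp hb
          replace hb := hb'
          right; exact hD b (h.2.2 b hb).2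
        · obtain ⟨a, ha', rfl⟩ := Finset.mem_image.mp ha
          replace ha := ha'
          left; exact hD a (h.2.2 a ha).2
        · exact h1.2.1 a ha b hb
      · intro a ha
        rcases Finset.mem_insert.mp ha with rfl | ha
        · exact hg
        · exact h1.2.2 a ha)
  refine ⟨c0, ?_⟩
  have h1 : V ≤ stage cs s w (cs.length w) := selfMap_le fun G => Finset.subset_insert _ _
  have h2 : V ≤ OrderHom.const _ c0 := by
    intro c
    change ({delta cs w, w} : Finset W) ⊆ insert w (insert (delta cs w) ((c.c.filter (Good cs s)).image (hI cs (cs.length w))))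
    intro x hx
    simp only [Finset.mem_insert, Finset.mem_singleton] at hx ⊢
    tauto
  exact (Ht.of_le h1).symm.trans (Ht.of_le h2)

end Pos

end WNC

theorem wordS1f_nerve_contractible (cs : CoxeterSystem M W) (s : B) (w : W)
    (hs : cs.IsLeftDescent w s)
    (htwo : ∃ s' : B, s' ≠ s ∧ cs.IsLeftDescent w s') :
    ContractibleSpace (SSet.toTop.obj (nerve (WordS1f cs s w))) := by
  obtain ⟨c, hc⟩ := WNC.exists_const cs s w hs htwo
  have h1 := (WNC.id_ht_stage cs s w (cs.length w)).trans hc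
  have h2 := h1.comp (WNC.toCh cs s w) (WNC.ofCh cs s w)
  have h3 := (WNC.Ht.of_le (WNC.id_le_ofCh_toCh cs s w)).trans h2
  exact WNC.contractible_of_ht (WNC.ofCh cs s w c) h3
end
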